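/- arXiv:1209.4588 — 11 statements merged into one kernel-verified Lean document; each statement's English description precedes it below -/
import Mathlib

section
/- Let q = (q_ℓ)_{ℓ≥2} be a sequence of complex numbers satisfying ∑_{ℓ=2}^∞ q_ℓ = 1, ∑_{ℓ=2}^∞ |q_ℓ| < ∞ and sup_{ℓ≥2} |q_ℓ| < 1. Then there exists a continuous function μ : [0,1] → ℂ with μ(0) = 0 and μ(1) = 1 such that μ(1/(ℓ−x)) = q_ℓ·μ(x) + ∑_{j=ℓ+1}^∞ q_j for every integer ℓ ≥ 2 and every x ∈ [0,1]. -/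
namespace QQuestionMark

/-- The continuous map of `[0,1]` into itself that sends `1 / s` to the projection of `ℓ - s`
to `[0,1]`, and `0` to `0`. -/
noncomputable def branch (ℓ : ℕ) (y : ℝ) : Set.Icc (0 : ℝ) 1 :=
  Set.projIcc 0 1 zero_le_one (ℓ - 1 / max y (1 / ℓ))

theorem continuous_branch {ℓ : ℕ} (hℓ : 0 < ℓ) : Continuous (branch ℓ) := by
  have h : (0 : ℝ) < 1 / ℓ := by positivity
  refine continuous_projIcc.comp (continuous_const.sub (continuous_const.div (by fun_prop) ?_))
  exact fun y => (lt_max_of_lt_right h).ne'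

theorem branch_zero (ℓ : ℕ) : branch ℓ 0 = 0 := by
  have h : (0 : ℝ) ≤ 1 / ℓ := by positivity
  rw [branch, max_eq_right h, one_div_one_div, sub_self]
  exact Set.projIcc_left _

theorem branch_one_div {ℓ : ℕ} (hℓ : 0 < ℓ) {s : ℝ} (hs : 0 < s) :
    branch ℓ (1 / s) = Set.projIcc 0 1 zero_le_one (ℓ - s) := by
  have hℓ' : (0 : ℝ) < ℓ := by exact_mod_cast hℓ
  rcases le_total s ℓ with h | h
  · rw [branch, max_eq_left (one_div_le_one_div_of_le hs h), one_div_one_div]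
  · rw [branch, max_eq_right (one_div_le_one_div_of_le hℓ' h), one_div_one_div, sub_self,
      Set.projIcc_of_le_left _ le_rfl, Set.projIcc_of_le_left _ (by linarith)]

theorem branch_one_div_of_le {ℓ : ℕ} (hℓ : 0 < ℓ) {s : ℝ} (hs : 0 < s) (h : ℓ ≤ s) :
    branch ℓ (1 / s) = 0 := by
  rw [branch_one_div hℓ hs]
  exact Set.projIcc_of_le_left _ (by linarith)

theorem branch_one_div_of_add_one_le {ℓ : ℕ} (hℓ : 0 < ℓ) {s : ℝ} (hs : 0 < s) (h : s + 1 ≤ ℓ) :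
    branch ℓ (1 / s) = 1 := by
  rw [branch_one_div hℓ hs]
  exact Set.projIcc_of_right_le _ (by linarith)

/-- At each point of `[0,1]` at most one branch takes a value other than the two endpoints. -/
theorem exists_forall_branch_eq_zero_or_one (y : Set.Icc (0 : ℝ) 1) :
    ∃ k : ℕ, ∀ j ≠ k, branch (j + 2) y = 0 ∨ branch (j + 2) y = 1 := by
  obtain ⟨y, hy0, hy1⟩ := y
  rcases hy0.eq_or_lt with rfl | hy
  · exact ⟨0, fun j _ => Or.inl (branch_zero _)⟩
  · obtain ⟨s, rfl⟩ : ∃ s : ℝ, y = 1 / s := ⟨1 / y, (one_div_one_div y).symm⟩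
    have hs : 0 < s := one_div_pos.mp hy
    have hs1 : 1 ≤ s := by rwa [div_le_one hs] at hy1
    have hf : 1 ≤ ⌊s⌋₊ := Nat.le_floor (by exact_mod_cast hs1)
    refine ⟨⌊s⌋₊ - 1, fun j hj => ?_⟩
    rcases Nat.lt_or_gt_of_ne hj with h | h
    · have hle : j + 2 ≤ ⌊s⌋₊ := by omega
      exact Or.inl (branch_one_div_of_le (by omega) hs ((Nat.le_floor_iff hs.le).mp hle))
    · have hle : ⌊s⌋₊ + 1 + 1 ≤ j + 2 := by omega
      have hle' : (⌊s⌋₊ : ℝ) + 1 + 1 ≤ ((j + 2 : ℕ) : ℝ) := by exact_mod_cast hle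
      have hlt := Nat.lt_floor_add_one s
      exact Or.inr (branch_one_div_of_add_one_le (by omega) hs (by linarith))

theorem summable_mul_branch {q : ℕ → ℂ} (habs : Summable fun ℓ : ℕ => ‖q (ℓ + 2)‖)
    (f : C(Set.Icc (0 : ℝ) 1, ℂ)) (y : ℝ) :
    Summable fun j : ℕ => q (j + 2) * f (branch (j + 2) y) := by
  refine Summable.of_norm_bounded (habs.mul_right ‖f‖) fun j => ?_
  rw [norm_mul]
  exact mul_le_mul_of_nonneg_left (f.norm_coe_le_norm _) (norm_nonneg _)

/-- The operator whose fixed points with values `0` and `1` at the endpoints are the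
`q`-question-mark functions. -/
noncomputable def operator (q : ℕ → ℂ) (habs : Summable fun ℓ : ℕ => ‖q (ℓ + 2)‖)
    (f : C(Set.Icc (0 : ℝ) 1, ℂ)) : C(Set.Icc (0 : ℝ) 1, ℂ) where
  toFun y := ∑' j : ℕ, q (j + 2) * f (branch (j + 2) y)
  continuous_toFun := by
    refine continuous_tsum (fun j => ?_) (habs.mul_right ‖f‖) fun j y => ?_
    · exact continuous_const.mul (f.continuous.comp
        ((continuous_branch (Nat.succ_pos _)).comp continuous_subtype_val))
    · rw [norm_mul]
      exact mul_le_mul_of_nonneg_left (f.norm_coe_le_norm _) (norm_nonneg _)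

theorem operator_apply (q : ℕ → ℂ) (habs : Summable fun ℓ : ℕ => ‖q (ℓ + 2)‖)
    (f : C(Set.Icc (0 : ℝ) 1, ℂ)) (y : Set.Icc (0 : ℝ) 1) :
    operator q habs f y = ∑' j : ℕ, q (j + 2) * f (branch (j + 2) y) :=
  rfl

/-- The continuous functions on `[0,1]` with value `0` at `0` and `1` at `1`. -/
def normalized : Set C(Set.Icc (0 : ℝ) 1, ℂ) := {f | f 0 = 0 ∧ f 1 = 1}

theorem isClosed_normalized : IsClosed normalized :=
  (isClosed_eq (continuous_eval_const 0) continuous_const).inter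
    (isClosed_eq (continuous_eval_const 1) continuous_const)

theorem nonempty_normalized : normalized.Nonempty :=
  ⟨⟨fun x => ((x : ℝ) : ℂ), by fun_prop⟩, by simp [normalized]⟩

theorem operator_mem_normalized {q : ℕ → ℂ} (hsum : HasSum (fun ℓ : ℕ => q (ℓ + 2)) 1)
    (habs : Summable fun ℓ : ℕ => ‖q (ℓ + 2)‖) {f : C(Set.Icc (0 : ℝ) 1, ℂ)}
    (hf : f ∈ normalized) : operator q habs f ∈ normalized := by
  constructor
  · simp [operator_apply, branch_zero, hf.1]
  · have h (j : ℕ) : branch (j + 2) 1 = 1 := by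
      have := branch_one_div_of_add_one_le (ℓ := j + 2) (by omega) one_pos
        (by push_cast; linarith [Nat.cast_nonneg (α := ℝ) j])
      rwa [div_one] at this
    simp [operator_apply, h, hf.2, hsum.tsum_eq]

theorem dist_operator_le {q : ℕ → ℂ} (habs : Summable fun ℓ : ℕ => ‖q (ℓ + 2)‖)
    {f g : C(Set.Icc (0 : ℝ) 1, ℂ)} (hf : f ∈ normalized) (hg : g ∈ normalized) :
    dist (operator q habs f) (operator q habs g) ≤ (⨆ ℓ : ℕ, ‖q (ℓ + 2)‖) * dist f g := by
  have hnonneg : 0 ≤ ⨆ ℓ : ℕ, ‖q (ℓ + 2)‖ := Real.iSup_nonneg fun _ => norm_nonneg _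
  have hbdd : BddAbove (Set.range fun ℓ : ℕ => ‖q (ℓ + 2)‖) :=
    habs.tendsto_atTop_zero.bddAbove_range
  refine (ContinuousMap.dist_le (mul_nonneg hnonneg dist_nonneg)).mpr fun y => ?_
  obtain ⟨k, hk⟩ := exists_forall_branch_eq_zero_or_one y
  rw [dist_eq_norm, operator_apply, operator_apply,
    ← (summable_mul_branch habs f y).tsum_sub (summable_mul_branch habs g y),
    tsum_eq_single k, ← mul_sub, norm_mul, ← dist_eq_norm]
  · exact mul_le_mul (le_ciSup hbdd k) (ContinuousMap.dist_apply_le_dist _) dist_nonneg hnonneg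
  · intro j hj
    rcases hk j hj with h | h
    · simp [h, hf.1, hg.1]
    · simp [h, hf.2, hg.2]

theorem exists_mem_normalized_operator_eq {q : ℕ → ℂ}
    (hsum : HasSum (fun ℓ : ℕ => q (ℓ + 2)) 1) (habs : Summable fun ℓ : ℕ => ‖q (ℓ + 2)‖)
    (hsup : (⨆ ℓ : ℕ, ‖q (ℓ + 2)‖) < 1) : ∃ f ∈ normalized, operator q habs f = f := by
  have : CompleteSpace normalized := isClosed_normalized.completeSpace_coe
  have : Nonempty normalized := nonempty_normalized.to_subtype
  let T : normalized → normalized :=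
    fun f => ⟨operator q habs f, operator_mem_normalized hsum habs f.2⟩
  have hT : ContractingWith ⟨⨆ ℓ : ℕ, ‖q (ℓ + 2)‖, Real.iSup_nonneg fun _ => norm_nonneg _⟩ T :=
    ⟨hsup, LipschitzWith.of_dist_le_mul fun f g => dist_operator_le habs f.2 g.2⟩
  exact ⟨_, (hT.fixedPoint T).2, congrArg Subtype.val hT.fixedPoint_isFixedPt⟩

theorem tsum_mul_branch {q : ℕ → ℂ} (habs : Summable fun ℓ : ℕ => ‖q (ℓ + 2)‖)
    {f : C(Set.Icc (0 : ℝ) 1, ℂ)} (hf : f ∈ normalized) (k : ℕ) (x : Set.Icc (0 : ℝ) 1) :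
    ∑' j : ℕ, q (j + 2) * f (branch (j + 2) (1 / (((k + 2 : ℕ) : ℝ) - x))) =
      q (k + 2) * f x + ∑' j : ℕ, q (k + 2 + 1 + j) := by
  obtain ⟨x, hx⟩ := x
  have hs : 0 < ((k + 2 : ℕ) : ℝ) - x := by
    push_cast
    linarith [hx.2, Nat.cast_nonneg (α := ℝ) k]
  rw [← (summable_mul_branch habs f _).sum_add_tsum_nat_add (k + 1), Finset.sum_range_succ,
    Finset.sum_eq_zero, zero_add]
  · congr 1
    · rw [branch_one_div (by omega) hs, sub_sub_cancel, Set.projIcc_of_mem _ hx]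
    · refine tsum_congr fun j => ?_
      rw [branch_one_div_of_add_one_le (by omega) hs, hf.2, mul_one]
      · congr 1
        omega
      · push_cast
        linarith [hx.1, Nat.cast_nonneg (α := ℝ) j]
  · intro j hj
    have hjk : (j : ℝ) + 1 ≤ k := by exact_mod_cast Finset.mem_range.mp hj
    rw [branch_one_div_of_le (by omega) hs, hf.1, mul_zero]
    push_cast
    linarith [hx.2]

end QQuestionMark

/-- existence of the q-question-mark function for a complex
sequence `q = (q_ℓ)_{ℓ ≥ 2}` with `∑ q_ℓ = 1`, `∑ |q_ℓ| < ∞`, `sup |q_ℓ| < 1`. -/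
theorem exists_q_question_mark_function (q : ℕ → ℂ)
    (hsum : HasSum (fun ℓ : ℕ => q (ℓ + 2)) 1)
    (habs : Summable (fun ℓ : ℕ => ‖q (ℓ + 2)‖))
    (hsup : (⨆ ℓ : ℕ, ‖q (ℓ + 2)‖) < 1) :
    ∃ μ : ℝ → ℂ, ContinuousOn μ (Set.Icc 0 1) ∧ μ 0 = 0 ∧ μ 1 = 1 ∧
      ∀ ℓ : ℕ, 2 ≤ ℓ → ∀ x ∈ Set.Icc (0 : ℝ) 1,
        μ (1 / ((ℓ : ℝ) - x)) = q ℓ * μ x + ∑' j : ℕ, q (ℓ + 1 + j) := by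
  obtain ⟨f, hf, hfix⟩ := QQuestionMark.exists_mem_normalized_operator_eq hsum habs hsup
  refine ⟨Set.IccExtend zero_le_one f, f.continuous.Icc_extend'.continuousOn,
    (Set.IccExtend_left _ _).trans hf.1, (Set.IccExtend_right _ _).trans hf.2, ?_⟩
  intro ℓ hℓ x hx
  obtain ⟨k, rfl⟩ := Nat.exists_eq_add_of_le' hℓ
  have hs : 1 ≤ ((k + 2 : ℕ) : ℝ) - x := by
    push_cast
    linarith [hx.2, Nat.cast_nonneg (α := ℝ) k]
  have hy : 1 / (((k + 2 : ℕ) : ℝ) - x) ∈ Set.Icc (0 : ℝ) 1 :=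
    ⟨by positivity, (div_le_one (by linarith)).mpr hs⟩
  rw [Set.IccExtend_of_mem _ _ hy, Set.IccExtend_of_mem _ _ hx,
    ← QQuestionMark.tsum_mul_branch habs hf k ⟨x, hx⟩]
  conv_lhs => rw [← hfix]
  rfl
end

section
/- Let q = (q_ℓ)_{ℓ≥2} be a sequence of real numbers with q_ℓ ≥ 0 for all ℓ, ∑_{ℓ=2}^∞ q_ℓ = 1 and sup_{ℓ≥2} q_ℓ < 1. Then there exists a continuous nondecreasing function μ : [0,1] → ℝ with μ(0) = 0, μ(1) = 1 and μ(1/(ℓ−x)) = q_ℓ·μ(x) + ∑_{j=ℓ+1}^∞ q_j for every integer ℓ ≥ 2 and x ∈ [0,1]. If moreover q_ℓ > 0 for all ℓ ≥ 2, then μ can be chosen strictly increasing. -/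
open Set unitInterval

/-- The continuous nondecreasing extension to `ℝ` of the inverse branch `y ↦ ℓ - 1 / y`, `ℓ = n + 2`,
which is `0` to the left of `[1 / ℓ, 1 / (ℓ - 1)]` and `1` to the right of it. -/
noncomputable def clampedBranch (n : ℕ) (y : ℝ) : I :=
  projIcc 0 1 zero_le_one ((n + 2 : ℝ) - 1 / max y (1 / (n + 2 : ℝ)))

lemma max_inv_branch_pos (n : ℕ) (y : ℝ) : 0 < max y (1 / (n + 2 : ℝ)) :=
  lt_max_of_lt_right (by positivity)

lemma continuous_clampedBranch (n : ℕ) : Continuous (clampedBranch n) := by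
  refine continuous_projIcc.comp (continuous_const.sub (continuous_const.div ?_ ?_))
  · fun_prop
  · exact fun y => (max_inv_branch_pos n y).ne'

lemma monotone_clampedBranch (n : ℕ) : Monotone (clampedBranch n) := by
  intro y z h
  refine monotone_projIcc _ (sub_le_sub_left ?_ _)
  exact one_div_le_one_div_of_le (max_inv_branch_pos n y) (max_le_max_right _ h)

lemma clampedBranch_of_le {n : ℕ} {y : ℝ} (h : y ≤ 1 / (n + 2 : ℝ)) : clampedBranch n y = 0 := by
  rw [clampedBranch, max_eq_right h]
  exact projIcc_of_le_left _ (by simp)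

lemma clampedBranch_of_ge {n : ℕ} {y : ℝ} (h : 1 / (n + 2 : ℝ) ≤ y) :
    clampedBranch n y = projIcc 0 1 zero_le_one ((n + 2 : ℝ) - 1 / y) := by
  rw [clampedBranch, max_eq_left h]

lemma clampedBranch_one (n : ℕ) : clampedBranch n 1 = 1 := by
  have hn : (0 : ℝ) ≤ n := n.cast_nonneg
  rw [clampedBranch_of_ge ((div_le_one (by positivity)).2 (by linarith))]
  exact projIcc_of_right_le _ (by linarith)

section Branch

variable {n : ℕ} {x : ℝ}

lemma branch_denom_pos (n : ℕ) (hx : x ∈ Icc (0 : ℝ) 1) : 0 < (n + 2 : ℝ) - x := by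
  have hn : (0 : ℝ) ≤ n := n.cast_nonneg
  linarith [hx.2]

lemma branch_mem_Icc (n : ℕ) (hx : x ∈ Icc (0 : ℝ) 1) : 1 / ((n + 2 : ℝ) - x) ∈ Icc (0 : ℝ) 1 := by
  have hn : (0 : ℝ) ≤ n := n.cast_nonneg
  have h := branch_denom_pos n hx
  exact ⟨by positivity, (div_le_one h).2 (by linarith [hx.2])⟩

lemma clampedBranch_branch_of_lt {m : ℕ} (hm : m < n) (hx : x ∈ Icc (0 : ℝ) 1) :
    clampedBranch m (1 / ((n + 2 : ℝ) - x)) = 0 := by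
  have hmn : (m : ℝ) + 1 ≤ n := by exact_mod_cast hm
  exact clampedBranch_of_le (one_div_le_one_div_of_le (by positivity) (by linarith [hx.2]))

lemma clampedBranch_branch_self (hx : x ∈ Icc (0 : ℝ) 1) :
    clampedBranch n (1 / ((n + 2 : ℝ) - x)) = ⟨x, hx⟩ := by
  rw [clampedBranch_of_ge (one_div_le_one_div_of_le (branch_denom_pos n hx) (by linarith [hx.1])),
    one_div_one_div, sub_sub_cancel, projIcc_of_mem]

lemma clampedBranch_branch_of_gt {m : ℕ} (hm : n < m) (hx : x ∈ Icc (0 : ℝ) 1) :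
    clampedBranch m (1 / ((n + 2 : ℝ) - x)) = 1 := by
  have hmn : (n : ℝ) + 1 ≤ m := by exact_mod_cast hm
  rw [clampedBranch_of_ge (one_div_le_one_div_of_le (branch_denom_pos n hx) (by linarith [hx.1])),
    one_div_one_div]
  exact projIcc_of_right_le _ (by linarith [hx.1])

/-- Every point of `(0, 1)` lies in `[1 / ℓ, 1 / (ℓ - 1))` for some `ℓ ≥ 2`. -/
lemma exists_branch {y : ℝ} (h0 : 0 < y) (h1 : y < 1) :
    ∃ (n : ℕ) (x : ℝ), 0 ≤ x ∧ x < 1 ∧ y = 1 / ((n + 2 : ℝ) - x) := by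
  have hy : 1 < 1 / y := by rwa [lt_div_iff₀ h0, one_mul]
  obtain ⟨n, hn⟩ : ∃ n : ℕ, ⌈1 / y⌉₊ = n + 2 :=
    Nat.exists_eq_add_of_le' (Nat.lt_ceil.2 (by simpa using hy))
  have hl := Nat.le_ceil (1 / y)
  have hr := Nat.ceil_lt_add_one (a := 1 / y) (by positivity)
  rw [hn] at hl hr
  push_cast at hl hr
  refine ⟨n, n + 2 - 1 / y, by linarith, by linarith, ?_⟩
  rw [sub_sub_cancel, one_div_one_div]

end Branch

section Transfer

variable {p : ℕ → ℝ}

lemma summable_mul_clampedBranch (hp : ∀ n, 0 ≤ p n) (hs : Summable p) (f : C(I, ℝ)) (y : ℝ) :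
    Summable fun n => p n * f (clampedBranch n y) := by
  refine Summable.of_norm_bounded (hs.mul_right ‖f‖) fun n => ?_
  rw [norm_mul, Real.norm_of_nonneg (hp n)]
  exact mul_le_mul_of_nonneg_left (f.norm_coe_le_norm _) (hp n)

/-- The operator whose fixed points are the question mark functions. -/
noncomputable def questionMarkOperator (hp : ∀ n, 0 ≤ p n) (hs : Summable p) (f : C(I, ℝ)) :
    C(I, ℝ) where
  toFun y := ∑' n, p n * f (clampedBranch n y)
  continuous_toFun := by
    refine continuous_tsum (u := fun n => p n * ‖f‖) (fun n => ?_) (hs.mul_right _) fun n y => ?_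
    · exact continuous_const.mul
        (f.continuous.comp ((continuous_clampedBranch n).comp continuous_subtype_val))
    · rw [norm_mul, Real.norm_of_nonneg (hp n)]
      exact mul_le_mul_of_nonneg_left (f.norm_coe_le_norm _) (hp n)

/-- The continuous nondecreasing functions on `[0, 1]` fixing `0` and `1`. -/
def normalizedMonotone : Set C(I, ℝ) := {f | Monotone f ∧ f 0 = 0 ∧ f 1 = 1}

lemma isClosed_normalizedMonotone : IsClosed normalizedMonotone := by
  have h (x : I) : Continuous fun f : C(I, ℝ) => f x := continuous_eval_const x
  refine IsClosed.and ?_ (IsClosed.and (isClosed_eq (h 0) continuous_const)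
    (isClosed_eq (h 1) continuous_const))
  simp only [Monotone, ofPred_forall]
  exact isClosed_iInter fun a => isClosed_iInter fun b => isClosed_iInter fun _ =>
    isClosed_le (h a) (h b)

variable (hp : ∀ n, 0 ≤ p n) (hs : Summable p)

lemma questionMarkOperator_zero {f : C(I, ℝ)} (h0 : f 0 = 0) :
    questionMarkOperator hp hs f 0 = 0 := by
  have h (n : ℕ) : clampedBranch n 0 = 0 := clampedBranch_of_le (by positivity)
  simp [questionMarkOperator, h, h0]

lemma questionMarkOperator_one {f : C(I, ℝ)} (h1 : f 1 = 1) :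
    questionMarkOperator hp hs f 1 = ∑' n, p n := by
  simp [questionMarkOperator, clampedBranch_one, h1]

lemma questionMarkOperator_branch {f : C(I, ℝ)} (h0 : f 0 = 0) (h1 : f 1 = 1) {n : ℕ} {x : ℝ}
    (hx : x ∈ Icc (0 : ℝ) 1) :
    questionMarkOperator hp hs f ⟨1 / ((n + 2 : ℝ) - x), branch_mem_Icc n hx⟩ =
      p n * f ⟨x, hx⟩ + ∑' j, p (j + (n + 1)) := by
  change ∑' m, p m * f (clampedBranch m (1 / ((n + 2 : ℝ) - x))) = _
  rw [← (summable_mul_clampedBranch hp hs f _).sum_add_tsum_nat_add (n + 1),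
    Finset.sum_range_succ, Finset.sum_eq_zero, zero_add, clampedBranch_branch_self hx]
  · congr 1
    refine tsum_congr fun j => ?_
    rw [clampedBranch_branch_of_gt (by omega) hx, h1, mul_one]
  · intro m hm
    rw [clampedBranch_branch_of_lt (Finset.mem_range.1 hm) hx, h0, mul_zero]

lemma monotone_questionMarkOperator {f : C(I, ℝ)} (hf : Monotone f) :
    Monotone (questionMarkOperator hp hs f) := by
  intro y z h
  exact (summable_mul_clampedBranch hp hs f y).tsum_le_tsum
    (fun n => mul_le_mul_of_nonneg_left (hf (monotone_clampedBranch n h)) (hp n))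
    (summable_mul_clampedBranch hp hs f z)

lemma mapsTo_questionMarkOperator (h1 : ∑' n, p n = 1) :
    MapsTo (questionMarkOperator hp hs) normalizedMonotone normalizedMonotone := fun _ hf =>
  ⟨monotone_questionMarkOperator hp hs hf.1, questionMarkOperator_zero hp hs hf.2.1,
    (questionMarkOperator_one hp hs hf.2.2).trans h1⟩

lemma dist_questionMarkOperator_le {c : ℝ} (hc : ∀ n, p n ≤ c) {f g : C(I, ℝ)}
    (hf : f ∈ normalizedMonotone) (hg : g ∈ normalizedMonotone) :
    dist (questionMarkOperator hp hs f) (questionMarkOperator hp hs g) ≤ c * dist f g := by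
  have hcd : 0 ≤ c * dist f g := mul_nonneg ((hp 0).trans (hc 0)) dist_nonneg
  refine (ContinuousMap.dist_le hcd).2 fun ⟨y, hy⟩ => ?_
  rcases hy.1.eq_or_lt with rfl | hy0
  · have := (questionMarkOperator_zero hp hs hf.2.1).trans
      (questionMarkOperator_zero hp hs hg.2.1).symm
    exact (dist_eq_zero.2 this).trans_le hcd
  rcases hy.2.eq_or_lt with rfl | hy1
  · have := (questionMarkOperator_one hp hs hf.2.2).trans
      (questionMarkOperator_one hp hs hg.2.2).symm
    exact (dist_eq_zero.2 this).trans_le hcd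
  obtain ⟨n, x, hx0, hx1, rfl⟩ := exists_branch hy0 hy1
  have hx : x ∈ Icc (0 : ℝ) 1 := ⟨hx0, hx1.le⟩
  rw [questionMarkOperator_branch hp hs hf.2.1 hf.2.2 hx,
    questionMarkOperator_branch hp hs hg.2.1 hg.2.2 hx, dist_add_right, Real.dist_eq,
    ← mul_sub, abs_mul, abs_of_nonneg (hp n), ← Real.dist_eq]
  exact mul_le_mul (hc n) (ContinuousMap.dist_apply_le_dist _) dist_nonneg ((hp 0).trans (hc 0))

lemma exists_fixedPoint_questionMarkOperator (h1 : ∑' n, p n = 1) {c : ℝ} (hc : ∀ n, p n ≤ c)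
    (hc1 : c < 1) : ∃ f ∈ normalizedMonotone, questionMarkOperator hp hs f = f := by
  have hmaps := mapsTo_questionMarkOperator hp hs h1
  have hK : ContractingWith ⟨c, (hp 0).trans (hc 0)⟩ (hmaps.restrict _ _ _) :=
    ⟨hc1, LipschitzWith.of_dist_le_mul fun f g =>
      dist_questionMarkOperator_le hp hs hc f.2 g.2⟩
  have hid : (⟨Subtype.val, continuous_subtype_val⟩ : C(I, ℝ)) ∈ normalizedMonotone :=
    ⟨fun _ _ h => h, rfl, rfl⟩
  obtain ⟨f, hf, hfix, -⟩ := hK.exists_fixedPoint' isClosed_normalizedMonotone.isComplete hmaps hid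
    (edist_ne_top _ _)
  exact ⟨f, hf, hfix⟩

end Transfer

/-- A continuous nondecreasing solution of the question mark equations with positive weights
`p n = q (n + 2)` is strictly increasing: a longest interval on which it is constant would be mapped
by an inverse branch to a longer one. -/
lemma strictMonoOn_of_question_mark_equation {p t : ℕ → ℝ} {μ : ℝ → ℝ} (hp : ∀ n, 0 < p n)
    (ht : ∀ n, 0 < t n) (hcont : ContinuousOn μ (Icc 0 1)) (hmono : MonotoneOn μ (Icc 0 1))
    (h0 : μ 0 = 0)
    (heq : ∀ n : ℕ, ∀ x ∈ Icc (0 : ℝ) 1, μ (1 / ((n + 2 : ℝ) - x)) = p n * μ x + t n) :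
    StrictMonoOn μ (Icc 0 1) := by
  have hz : (0 : ℝ) ∈ Icc (0 : ℝ) 1 := ⟨le_rfl, zero_le_one⟩
  have hμpos : ∀ x ∈ Icc (0 : ℝ) 1, 0 < x → 0 < μ x := by
    intro x hx hx0
    obtain ⟨n, hn⟩ := exists_nat_one_div_lt hx0
    have hle : 1 / ((n + 2 : ℝ) - 0) ≤ x :=
      (one_div_le_one_div_of_le (by positivity) (by linarith)).trans hn.le
    have := heq n 0 hz
    rw [h0, mul_zero, zero_add] at this
    exact (ht n).trans_le (this ▸ hmono (branch_mem_Icc n hz) hx hle)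
  by_contra hstrict
  obtain ⟨a, ha, b, hb, hab, hμab⟩ : ∃ a ∈ Icc (0 : ℝ) 1, ∃ b ∈ Icc (0 : ℝ) 1, a < b ∧ μ a = μ b := by
    simp only [StrictMonoOn, not_forall, not_lt] at hstrict
    obtain ⟨a, ha, b, hb, hab, h⟩ := hstrict
    exact ⟨a, ha, b, hb, hab, (hmono ha hb hab.le).antisymm h⟩
  have hK : IsCompact {z ∈ Icc (0 : ℝ) 1 ×ˢ Icc (0 : ℝ) 1 | μ z.1 = μ z.2} := by
    refine (isCompact_Icc.prod isCompact_Icc).of_isClosed_subset ?_ (sep_subset _ _)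
    have hclosed : IsClosed (Icc (0 : ℝ) 1 ×ˢ Icc (0 : ℝ) 1) := isClosed_Icc.prod isClosed_Icc
    have hd : ContinuousOn (fun z : ℝ × ℝ => μ z.1 - μ z.2) (Icc (0 : ℝ) 1 ×ˢ Icc (0 : ℝ) 1) :=
      (hcont.comp continuousOn_fst fun z hz => hz.1).sub
        (hcont.comp continuousOn_snd fun z hz => hz.2)
    convert hd.preimage_isClosed_of_isClosed hclosed (isClosed_singleton (x := (0 : ℝ))) using 1
    ext z
    simp [sub_eq_zero]
  obtain ⟨⟨u, v⟩, ⟨⟨hu, hv⟩, huv⟩, hmax⟩ := hK.exists_isMaxOn ⟨(a, b), ⟨ha, hb⟩, hμab⟩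
    (f := fun z : ℝ × ℝ => z.2 - z.1) (by fun_prop)
  have hmax' : ∀ x ∈ Icc (0 : ℝ) 1, ∀ y ∈ Icc (0 : ℝ) 1, μ x = μ y → y - x ≤ v - u :=
    fun x hx y hy h => hmax (a := (x, y)) ⟨⟨hx, hy⟩, h⟩
  dsimp only at hu hv huv
  have huv_lt : u < v := by linarith [hmax' a ha b hb hμab]
  have hu0 : 0 < u := by
    refine hu.1.lt_of_ne ?_
    rintro rfl
    exact (hμpos v hv huv_lt).ne (h0 ▸ huv)
  have hu1 : u < 1 := huv_lt.trans_le hv.2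
  have hv0 : 0 < v := hu0.trans huv_lt
  obtain ⟨n, x, hx0, hx1, hux⟩ := exists_branch hu0 hu1
  have hx : x ∈ Icc (0 : ℝ) 1 := ⟨hx0, hx1.le⟩
  have hxu : x = n + 2 - 1 / u := by rw [hux, one_div_one_div]; ring
  set y : ℝ := n + 2 - 1 / v with hy_def
  have hvy : v = 1 / ((n + 2 : ℝ) - y) := by rw [hy_def, sub_sub_cancel, one_div_one_div]
  have hxy : x < y := by
    rw [hxu, hy_def]
    exact sub_lt_sub_left (one_div_lt_one_div_of_lt hu0 huv_lt) _
  rcases le_or_gt y 1 with hy1 | hy1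
  · have hy : y ∈ Icc (0 : ℝ) 1 := ⟨hx0.trans hxy.le, hy1⟩
    have hμxy : μ x = μ y := by
      rw [hux, hvy, heq n x hx, heq n y hy] at huv
      exact mul_left_cancel₀ (hp n).ne' (add_right_cancel huv)
    have hle := hmax' x hx y hy hμxy
    have hdiff : y - x = (v - u) / (u * v) := by
      rw [hxu, hy_def]
      field_simp
      ring
    rw [hdiff, div_le_iff₀ (mul_pos hu0 hv0)] at hle
    have huv1 : u * v < 1 := by nlinarith [hv.2]
    nlinarith
  · -- here `1 / (n + 1)` lies strictly between `u` and `v`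
    obtain ⟨m, rfl⟩ : ∃ m, n = m + 1 := by
      refine Nat.exists_eq_add_one_of_ne_zero ?_
      rintro rfl
      have : 1 ≤ 1 / v := (one_le_div hv0).2 hv.2
      rw [hy_def] at hy1
      push_cast at hy1
      linarith
    push_cast at hux hvy
    set w : ℝ := min 1 (y - 1)
    have hw0 : 0 < w := lt_min one_pos (by linarith)
    have hw : w ∈ Icc (0 : ℝ) 1 := ⟨hw0.le, min_le_left _ _⟩
    have hwv : 1 / ((m + 2 : ℝ) - w) ≤ v := by
      have hd : 0 < (m + 1 + 2 : ℝ) - y := by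
        rw [hvy] at hv0
        exact one_div_pos.1 hv0
      rw [hvy]
      exact one_div_le_one_div_of_le hd (by linarith [min_le_right 1 (y - 1)])
    have huz : u ≤ 1 / ((m + 2 : ℝ) - 0) := by
      rw [hux]
      exact one_div_le_one_div_of_le (branch_denom_pos m hz) (by linarith)
    have hl := hmono hu (branch_mem_Icc m hz) huz
    have hr := hmono (branch_mem_Icc m hw) hv hwv
    rw [heq m 0 hz, h0] at hl
    rw [heq m w hw] at hr
    linarith [mul_pos (hp m) (hμpos w hw hw0)]

/-- for a nonnegative real sequence `q = (q_ℓ)_{ℓ ≥ 2}` with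
`∑ q_ℓ = 1` and `sup q_ℓ < 1`, there is a continuous nondecreasing
q-question-mark function; if all `q_ℓ > 0`, it can be chosen strictly increasing. -/
theorem exists_monotone_q_question_mark_function (q : ℕ → ℝ)
    (hpos : ∀ ℓ : ℕ, 2 ≤ ℓ → 0 ≤ q ℓ)
    (hsum : HasSum (fun ℓ : ℕ => q (ℓ + 2)) 1)
    (hsup : (⨆ ℓ : ℕ, q (ℓ + 2)) < 1) :
    (∃ μ : ℝ → ℝ, ContinuousOn μ (Set.Icc 0 1) ∧ MonotoneOn μ (Set.Icc 0 1) ∧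
      μ 0 = 0 ∧ μ 1 = 1 ∧
      ∀ ℓ : ℕ, 2 ≤ ℓ → ∀ x ∈ Set.Icc (0 : ℝ) 1,
        μ (1 / ((ℓ : ℝ) - x)) = q ℓ * μ x + ∑' j : ℕ, q (ℓ + 1 + j)) ∧
    ((∀ ℓ : ℕ, 2 ≤ ℓ → 0 < q ℓ) →
      ∃ μ : ℝ → ℝ, ContinuousOn μ (Set.Icc 0 1) ∧ StrictMonoOn μ (Set.Icc 0 1) ∧
        μ 0 = 0 ∧ μ 1 = 1 ∧
        ∀ ℓ : ℕ, 2 ≤ ℓ → ∀ x ∈ Set.Icc (0 : ℝ) 1,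
          μ (1 / ((ℓ : ℝ) - x)) = q ℓ * μ x + ∑' j : ℕ, q (ℓ + 1 + j)) := by
  have hp : ∀ n, 0 ≤ q (n + 2) := fun n => hpos _ (Nat.le_add_left 2 n)
  have hbdd : BddAbove (range fun ℓ : ℕ => q (ℓ + 2)) := by
    refine ⟨1, ?_⟩
    rintro _ ⟨n, rfl⟩
    exact le_hasSum hsum n fun j _ => hp j
  obtain ⟨f, ⟨hmono, hf0, hf1⟩, hfix⟩ := exists_fixedPoint_questionMarkOperator hp hsum.summable
    hsum.tsum_eq (le_ciSup hbdd) hsup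
  have hcont' : ContinuousOn (IccExtend zero_le_one f) (Icc (0 : ℝ) 1) :=
    f.continuous.Icc_extend'.continuousOn
  have hmono' : MonotoneOn (IccExtend zero_le_one f) (Icc (0 : ℝ) 1) :=
    (hmono.IccExtend zero_le_one).monotoneOn _
  have h0 : IccExtend (zero_le_one' ℝ) f 0 = 0 := (IccExtend_left _ _).trans hf0
  have h1 : IccExtend (zero_le_one' ℝ) f 1 = 1 := (IccExtend_right _ _).trans hf1
  have hbranch : ∀ n : ℕ, ∀ x ∈ Icc (0 : ℝ) 1,
      IccExtend (zero_le_one' ℝ) f (1 / ((n + 2 : ℝ) - x)) =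
        q (n + 2) * IccExtend (zero_le_one' ℝ) f x + ∑' j, q (j + (n + 1) + 2) := by
    intro n x hx
    rw [IccExtend_of_mem _ _ (branch_mem_Icc n hx), IccExtend_of_mem _ _ hx]
    conv_lhs => rw [← hfix]
    exact questionMarkOperator_branch hp hsum.summable hf0 hf1 hx
  have heq : ∀ ℓ : ℕ, 2 ≤ ℓ → ∀ x ∈ Icc (0 : ℝ) 1,
      IccExtend (zero_le_one' ℝ) f (1 / ((ℓ : ℝ) - x)) =
        q ℓ * IccExtend (zero_le_one' ℝ) f x + ∑' j : ℕ, q (ℓ + 1 + j) := by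
    intro ℓ hℓ x hx
    obtain ⟨n, rfl⟩ := Nat.exists_eq_add_of_le' hℓ
    push_cast
    rw [hbranch n x hx]
    congr 1
    exact tsum_congr fun j => congrArg q (by omega)
  refine ⟨⟨_, hcont', hmono', h0, h1, heq⟩, fun hq => ⟨_, hcont', ?_, h0, h1, heq⟩⟩
  refine strictMonoOn_of_question_mark_equation (fun n => hq (n + 2) (Nat.le_add_left 2 n))
    (fun n => ?_) hcont' hmono' h0 hbranch
  exact ((summable_nat_add_iff (n + 1)).2 hsum.summable).tsum_pos (fun j => hp _) 0
    (hq _ (Nat.le_add_left 2 _))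
end

section
/- Let μ : [0,1] → ℝ be a continuous function with μ(0) = 0, μ(1) = 1 satisfying μ(1/(ℓ−x)) = 2^{1−ℓ}·(μ(x) + 1) for every integer ℓ ≥ 2 and every x ∈ [0,1]. Then μ satisfies the Minkowski question-mark functional equations: μ(x/(1+x)) = μ(x)/2 and μ(1−x) = 1 − μ(x) for all x ∈ [0,1]. -/
/-- A continuous function on `[0,1]` that is symmetric about `1/2` and is halved by
`x ↦ x / (1 + x)` vanishes. -/
theorem eq_zero_of_symm_of_halving {F : ℝ → ℝ} (hcont : ContinuousOn F (Set.Icc 0 1))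
    (hsymm : ∀ x ∈ Set.Icc (0 : ℝ) 1, F (1 - x) = F x)
    (hhalf : ∀ x ∈ Set.Icc (0 : ℝ) 1, F (x / (1 + x)) = F x / 2) :
    ∀ x ∈ Set.Icc (0 : ℝ) 1, F x = 0 := by
  have hbound : ∀ M, (∀ y ∈ Set.Icc (0 : ℝ) 1, |F y| ≤ M) →
      ∀ x ∈ Set.Icc (0 : ℝ) 1, |F x| ≤ M / 2 := by
    intro M hM
    have hleft : ∀ x ∈ Set.Icc (0 : ℝ) 1, x ≤ 1 / 2 → |F x| ≤ M / 2 := by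
      rintro x ⟨hx0, hx1⟩ hx
      have hpos : 0 < 1 - x := by linarith
      have ht : x / (1 - x) ∈ Set.Icc (0 : ℝ) 1 :=
        ⟨by positivity, (div_le_one hpos).2 (by linarith)⟩
      have hxt : x / (1 - x) / (1 + x / (1 - x)) = x := by
        have : 1 + x / (1 - x) = 1 / (1 - x) := by field_simp; ring
        rw [this]
        field_simp
      have h := hhalf _ ht
      rw [hxt] at h
      rw [h, abs_div, abs_two]
      linarith [hM _ ht]
    intro x hx
    rcases le_total x (1 / 2) with h | h
    · exact hleft x hx h
    · rw [← hsymm x hx]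
      exact hleft _ ⟨by linarith [hx.2], by linarith [hx.1]⟩ (by linarith)
  obtain ⟨x₀, hx₀, hmax⟩ := isCompact_Icc.exists_isMaxOn
    (Set.nonempty_Icc.2 zero_le_one) hcont.abs
  have h₀ := hbound _ (fun y hy => hmax hy) x₀ hx₀
  intro x hx
  have hle : |F x| ≤ |F x₀| := hmax hx
  exact abs_nonpos_iff.1 (by linarith)

/-- Every point of `(0,1]` has the form `1 / (ℓ - y)` with `ℓ ≥ 2` an integer and `y ∈ [0,1]`. -/
theorem exists_eq_one_div_natCast_sub {x : ℝ} (hx0 : 0 < x) (hx1 : x ≤ 1) :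
    ∃ ℓ : ℕ, 2 ≤ ℓ ∧ ∃ y ∈ Set.Icc (0 : ℝ) 1, x = 1 / ((ℓ : ℝ) - y) := by
  have hinv : 1 ≤ x⁻¹ := (one_le_inv₀ hx0).2 hx1
  have hfloor : 1 ≤ ⌊x⁻¹⌋₊ := Nat.le_floor (by exact_mod_cast hinv)
  have hle := Nat.floor_le (zero_le_one.trans hinv)
  have hlt := Nat.lt_floor_add_one x⁻¹
  refine ⟨⌊x⁻¹⌋₊ + 1, by omega, ⌊x⁻¹⌋₊ + 1 - x⁻¹, ⟨by linarith, by linarith⟩, ?_⟩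
  push_cast
  rw [sub_sub_cancel, one_div, inv_inv]


/-- a continuous `μ` on `[0,1]` with `μ 0 = 0`, `μ 1 = 1` and
`μ(1/(ℓ−x)) = 2^{1−ℓ}(μ(x)+1)` for all integers `ℓ ≥ 2` satisfies the
Minkowski question-mark functional equations. -/
theorem minkowski_functional_equations (μ : ℝ → ℝ)
    (hcont : ContinuousOn μ (Set.Icc 0 1)) (h0 : μ 0 = 0) (h1 : μ 1 = 1)
    (hself : ∀ ℓ : ℕ, 2 ≤ ℓ → ∀ x ∈ Set.Icc (0 : ℝ) 1,
      μ (1 / ((ℓ : ℝ) - x)) = (2 : ℝ) ^ ((1 : ℤ) - (ℓ : ℤ)) * (μ x + 1)) :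
    ∀ x ∈ Set.Icc (0 : ℝ) 1,
      μ (x / (1 + x)) = μ x / 2 ∧ μ (1 - x) = 1 - μ x := by
  have hhalf : ∀ x ∈ Set.Icc (0 : ℝ) 1, μ (x / (1 + x)) = μ x / 2 := by
    rintro x ⟨hx0, hx1⟩
    rcases hx0.eq_or_lt with rfl | hpos
    · simp [h0]
    obtain ⟨ℓ, hℓ, y, hy, rfl⟩ := exists_eq_one_div_natCast_sub hpos hx1
    have hd : 0 < (ℓ : ℝ) - y := one_div_pos.1 hpos
    have harg : 1 / ((ℓ : ℝ) - y) / (1 + 1 / (ℓ - y)) = 1 / (((ℓ + 1 : ℕ) : ℝ) - y) := by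
      have : (ℓ : ℝ) + 1 - y ≠ 0 := by linarith
      have : (ℓ : ℝ) - y + 1 ≠ 0 := by linarith
      push_cast
      field_simp
      ring
    have hpow : (2 : ℝ) ^ ((1 : ℤ) - ((ℓ + 1 : ℕ) : ℤ)) = 2 ^ ((1 : ℤ) - (ℓ : ℤ)) / 2 := by
      rw [div_eq_mul_inv, ← zpow_sub_one₀ two_ne_zero]
      congr 1
      push_cast
      ring
    rw [harg, hself (ℓ + 1) (by omega) y hy, hself ℓ hℓ y hy, hpow]
    ring
  have hreflect : Set.MapsTo (fun x : ℝ => 1 - x) (Set.Icc 0 1) (Set.Icc 0 1) :=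
    fun x hx => ⟨by linarith [hx.2], by linarith [hx.1]⟩
  have hzero := eq_zero_of_symm_of_halving (F := fun x => μ x + μ (1 - x) - 1)
    ((hcont.add (hcont.comp (by fun_prop) hreflect)).sub continuousOn_const)
    (fun x _ => by simp only [sub_sub_cancel]; ring)
    (fun x hx => by
      have hd : 1 + x ≠ 0 := by linarith [hx.1]
      have harg : 1 - x / (1 + x) = 1 / (((2 : ℕ) : ℝ) - (1 - x)) := by
        have : 2 - (1 - x) = 1 + x := by ring
        rw [Nat.cast_ofNat, this]
        field_simp
        ring
      have hpow : (2 : ℝ) ^ ((1 : ℤ) - ((2 : ℕ) : ℤ)) = 1 / 2 := by norm_num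
      simp only [harg, hself 2 le_rfl _ (hreflect hx), hhalf x hx, hpow]
      ring)
  exact fun x hx => ⟨hhalf x hx, by linarith [hzero x hx]⟩
end

section
/- Let q = (q_ℓ)_{ℓ≥2} be real numbers with q_ℓ ≥ 0, ∑_{ℓ=2}^∞ q_ℓ = 1 and sup_{ℓ≥2} q_ℓ < 1, and let μ : [0,1] → ℝ be a continuous nondecreasing function with μ(0)=0, μ(1)=1 satisfying μ(1/(ℓ−x)) = q_ℓ·μ(x) + ∑_{j=ℓ+1}^∞ q_j for all ℓ ≥ 2, x ∈ [0,1]. Let λ_μ be the Lebesgue–Stieltjes measure on [0,1] associated to μ. Then for every continuous function f : [0,1] → ℂ, ∫_{[0,1]} f dλ_μ = ∑_{ℓ=2}^∞ q_ℓ · ∫_{[0,1]} f(1/(ℓ−x)) dλ_μ(x), the series on the right converging absolutely. -/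
open MeasureTheory

/-- A function continuous on a compact set is integrable against any finite measure concentrated
on that set. -/
lemma ContinuousOn.integrable_of_measure_compl_eq_zero {f : ℝ → ℂ} {K : Set ℝ}
    (hf : ContinuousOn f K) (hK : IsCompact K) {ν : Measure ℝ} [IsFiniteMeasure ν]
    (hν : ν Kᶜ = 0) : Integrable f ν := by
  have h := hf.integrableOn_compact (μ := ν) hK
  rwa [IntegrableOn, Measure.restrict_eq_self_of_ae_mem (mem_ae_iff.2 hν)] at h

/-- The distribution function of a measure on `(0,1]` with primitive `μ`. -/
lemma measure_Iic_eq_ofReal_clamp {μ : ℝ → ℝ} (h0 : μ 0 = 0) {ν : Measure ℝ}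
    (hconc : ν (Set.Ioc (0 : ℝ) 1)ᶜ = 0)
    (hν : ∀ a ∈ Set.Icc (0 : ℝ) 1, ∀ b ∈ Set.Icc (0 : ℝ) 1, a ≤ b →
      ν (Set.Ioc a b) = ENNReal.ofReal (μ b - μ a)) (a : ℝ) :
    ν (Set.Iic a) = ENNReal.ofReal (μ (max 0 (min 1 a))) := by
  have hc0 : 0 ≤ max 0 (min 1 a) := le_max_left _ _
  have hc1 : max 0 (min 1 a) ≤ 1 := max_le zero_le_one (min_le_left _ _)
  have hIoc := hν 0 (by simp) _ ⟨hc0, hc1⟩ hc0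
  rw [h0, sub_zero] at hIoc
  rw [← hIoc, ← measure_inter_conull (s := Set.Iic a) hconc]
  congr 1
  ext x
  simp only [Set.mem_inter_iff, Set.mem_Iic, Set.mem_Ioc, le_max_iff, le_min_iff]
  constructor
  · rintro ⟨h, h', h''⟩
    exact ⟨h', Or.inr ⟨h'', h⟩⟩
  · rintro ⟨h, h' | h'⟩
    · exact absurd h' (not_le.2 h)
    · exact ⟨h'.2, h, h'.1⟩

/-- The self-similarity of `μ`, as a sum over all the branches. -/
lemma hasSum_self_similarity {q : ℕ → ℝ} (hsum : HasSum (fun ℓ : ℕ => q (ℓ + 2)) 1)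
    {μ : ℝ → ℝ} (h0 : μ 0 = 0) (h1 : μ 1 = 1)
    (hself : ∀ ℓ : ℕ, 2 ≤ ℓ → ∀ x ∈ Set.Icc (0 : ℝ) 1,
      μ (1 / ((ℓ : ℝ) - x)) = q ℓ * μ x + ∑' j : ℕ, q (ℓ + 1 + j))
    {a : ℝ} (ha0 : 0 < a) (ha1 : a < 1) :
    HasSum (fun ℓ : ℕ => q (ℓ + 2) * μ (max 0 (min 1 ((ℓ : ℝ) + 2 - 1 / a)))) (μ a) := by
  have hone : 1 < 1 / a := by rwa [lt_div_iff₀ ha0, one_mul]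
  obtain ⟨n, hn⟩ : ∃ n, ⌈1 / a⌉₊ = n + 2 := by
    have : 1 < ⌈1 / a⌉₊ := Nat.lt_ceil.2 (by simpa using hone)
    exact ⟨⌈1 / a⌉₊ - 2, by omega⟩
  have hle : 1 / a ≤ (n : ℝ) + 2 := by
    have := Nat.le_ceil (1 / a)
    rw [hn] at this
    exact_mod_cast this
  have hlt : (n : ℝ) + 1 < 1 / a := by
    have := Nat.ceil_lt_add_one (zero_le_one.trans hone.le)
    rw [hn] at this
    push_cast at this
    linarith
  have hμa : μ a = q (n + 2) * μ ((n : ℝ) + 2 - 1 / a) + ∑' j : ℕ, q (n + 2 + 1 + j) := by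
    rw [← hself (n + 2) (by omega) _ ⟨by linarith, by linarith⟩]
    congr 1
    push_cast
    rw [sub_sub_cancel, one_div_one_div]
  rw [← hasSum_nat_add_iff' (n + 1), Finset.sum_range_succ, Finset.sum_eq_zero, zero_add,
    min_eq_right (by linarith : (n : ℝ) + 2 - 1 / a ≤ 1), max_eq_right (by linarith), hμa,
    add_sub_cancel_left]
  · have htail : Summable fun j : ℕ => q (n + 2 + 1 + j) :=
      ((summable_nat_add_iff (n + 1)).2 hsum.summable).congr fun j => by congr 1; omega
    refine htail.hasSum.congr_fun fun j => ?_
    rw [min_eq_left, max_eq_right zero_le_one, h1, mul_one]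
    · congr 1
      omega
    · push_cast
      have : (0 : ℝ) ≤ j := j.cast_nonneg
      linarith
  · intro i hi
    have : (i : ℝ) + 1 ≤ n := by exact_mod_cast Finset.mem_range.1 hi
    rw [max_eq_left ((min_le_right _ _).trans (by linarith)), h0, mul_zero]

/-- A self-similar measure on `(0,1]` is the mixture of its images under the branches
`x ↦ 1 / (ℓ - x)`. -/
lemma eq_sum_smul_map_of_self_similar {q : ℕ → ℝ} (hpos : ∀ ℓ : ℕ, 2 ≤ ℓ → 0 ≤ q ℓ)
    (hsum : HasSum (fun ℓ : ℕ => q (ℓ + 2)) 1)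
    {μ : ℝ → ℝ} (hmono : MonotoneOn μ (Set.Icc 0 1)) (h0 : μ 0 = 0) (h1 : μ 1 = 1)
    (hself : ∀ ℓ : ℕ, 2 ≤ ℓ → ∀ x ∈ Set.Icc (0 : ℝ) 1,
      μ (1 / ((ℓ : ℝ) - x)) = q ℓ * μ x + ∑' j : ℕ, q (ℓ + 1 + j))
    {ν : Measure ℝ} [IsFiniteMeasure ν] (hconc : ν (Set.Ioc (0 : ℝ) 1)ᶜ = 0)
    (hν : ∀ a ∈ Set.Icc (0 : ℝ) 1, ∀ b ∈ Set.Icc (0 : ℝ) 1, a ≤ b →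
      ν (Set.Ioc a b) = ENNReal.ofReal (μ b - μ a)) :
    ν = Measure.sum fun ℓ : ℕ =>
      ENNReal.ofReal (q (ℓ + 2)) • ν.map fun x => 1 / ((ℓ : ℝ) + 2 - x) := by
  have hIic := measure_Iic_eq_ofReal_clamp h0 hconc hν
  have hq : ∀ ℓ : ℕ, 0 ≤ q (ℓ + 2) := fun ℓ => hpos _ (by omega)
  refine Measure.ext_of_Iic _ _ fun a => ?_
  have hmap : ∀ ℓ : ℕ, (ν.map fun x => 1 / ((ℓ : ℝ) + 2 - x)) (Set.Iic a) =
      ν ({x | 1 / ((ℓ : ℝ) + 2 - x) ≤ a} ∩ Set.Ioc 0 1) := fun ℓ => by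
    rw [Measure.map_apply (by fun_prop) measurableSet_Iic, measure_inter_conull hconc]
    rfl
  have hden : ∀ ℓ : ℕ, ∀ x ∈ Set.Ioc (0 : ℝ) 1, 1 ≤ (ℓ : ℝ) + 2 - x := fun ℓ x hx => by
    have : (0 : ℝ) ≤ ℓ := ℓ.cast_nonneg
    linarith [hx.2]
  rw [Measure.sum_apply _ measurableSet_Iic]
  simp only [Measure.smul_apply, smul_eq_mul, hmap]
  rcases le_or_gt a 0 with ha | ha
  · rw [hIic, max_eq_left ((min_le_right _ _).trans ha), h0, ENNReal.ofReal_zero]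
    refine (ENNReal.tsum_eq_zero.2 fun ℓ => ?_).symm
    rw [Set.eq_empty_of_forall_notMem (s := _ ∩ _), measure_empty, mul_zero]
    rintro x ⟨hxa, hx⟩
    have : 0 < 1 / ((ℓ : ℝ) + 2 - x) := one_div_pos.2 (by linarith [hden ℓ x hx])
    exact absurd (hxa.trans ha) (not_le.2 this)
  rcases le_or_gt 1 a with ha1 | ha1
  · have hall : ∀ ℓ : ℕ, {x | 1 / ((ℓ : ℝ) + 2 - x) ≤ a} ∩ Set.Ioc 0 1 = Set.Ioc 0 1 :=
      fun ℓ => Set.inter_eq_right.2 fun x hx =>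
        ((div_le_one (by linarith [hden ℓ x hx])).2 (hden ℓ x hx)).trans ha1
    simp only [hall, hν 0 (by simp) 1 (by simp) zero_le_one, h0, h1, sub_zero,
      ENNReal.ofReal_one, mul_one]
    rw [hIic, min_eq_left ha1, max_eq_right zero_le_one, h1,
      ← ENNReal.ofReal_tsum_of_nonneg hq hsum.summable, hsum.tsum_eq]
  · have hset : ∀ ℓ : ℕ, {x | 1 / ((ℓ : ℝ) + 2 - x) ≤ a} ∩ Set.Ioc 0 1 =
        Set.Iic ((ℓ : ℝ) + 2 - 1 / a) ∩ Set.Ioc 0 1 := fun ℓ => by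
      ext x
      refine and_congr_left fun hx => ?_
      rw [Set.mem_ofPred_eq, one_div_le (by linarith [hden ℓ x hx]) ha, Set.mem_Iic, le_sub_comm]
    have hs := hasSum_self_similarity hsum h0 h1 hself ha ha1
    simp only [hset, measure_inter_conull hconc, hIic, ← ENNReal.ofReal_mul (hq _)]
    rw [← ENNReal.ofReal_tsum_of_nonneg _ hs.summable, hs.tsum_eq, min_eq_right ha1.le,
      max_eq_right ha.le]
    intro ℓ
    have hc0 : 0 ≤ max 0 (min 1 ((ℓ : ℝ) + 2 - 1 / a)) := le_max_left _ _
    have hc1 : max 0 (min 1 ((ℓ : ℝ) + 2 - 1 / a)) ≤ 1 := max_le zero_le_one (min_le_left _ _)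
    exact mul_nonneg (hq ℓ) (h0.ge.trans (hmono (by simp) ⟨hc0, hc1⟩ hc0))

/-- the self-similarity of a q-question-mark function transfers
to its Lebesgue–Stieltjes measure: for every continuous `f : [0,1] → ℂ`,
`∫ f dλ_μ = ∑_{ℓ≥2} q_ℓ ∫ f(1/(ℓ−x)) dλ_μ(x)`, absolutely convergently. -/
theorem stieltjes_self_similarity (q : ℕ → ℝ)
    (hpos : ∀ ℓ : ℕ, 2 ≤ ℓ → 0 ≤ q ℓ)
    (hsum : HasSum (fun ℓ : ℕ => q (ℓ + 2)) 1)
    (hsup : (⨆ ℓ : ℕ, q (ℓ + 2)) < 1)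
    (μ : ℝ → ℝ) (hcont : ContinuousOn μ (Set.Icc 0 1))
    (hmono : MonotoneOn μ (Set.Icc 0 1)) (h0 : μ 0 = 0) (h1 : μ 1 = 1)
    (hself : ∀ ℓ : ℕ, 2 ≤ ℓ → ∀ x ∈ Set.Icc (0 : ℝ) 1,
      μ (1 / ((ℓ : ℝ) - x)) = q ℓ * μ x + ∑' j : ℕ, q (ℓ + 1 + j))
    (μLS : Measure ℝ) [IsFiniteMeasure μLS]
    (hconc : μLS (Set.Ioc (0 : ℝ) 1)ᶜ = 0)
    (hμLS : ∀ a ∈ Set.Icc (0 : ℝ) 1, ∀ b ∈ Set.Icc (0 : ℝ) 1, a ≤ b →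
      μLS (Set.Ioc a b) = ENNReal.ofReal (μ b - μ a)) :
    ∀ f : ℝ → ℂ, ContinuousOn f (Set.Icc 0 1) →
      Summable (fun ℓ : ℕ =>
        ‖(q (ℓ + 2) : ℂ) * ∫ x, f (1 / ((ℓ : ℝ) + 2 - x)) ∂μLS‖) ∧
      ∫ x, f x ∂μLS =
        ∑' ℓ : ℕ, (q (ℓ + 2) : ℂ) * ∫ x, f (1 / ((ℓ : ℝ) + 2 - x)) ∂μLS := by
  intro f hf
  have hsupp : ∀ ℓ : ℕ,
      (μLS.map fun x => 1 / ((ℓ : ℝ) + 2 - x)) (Set.Icc (0 : ℝ) 1)ᶜ = 0 := fun ℓ => by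
    rw [Measure.map_apply (by fun_prop) measurableSet_Icc.compl]
    refine measure_mono_null (Set.compl_subset_compl.2 fun x hx' => ?_) hconc
    have : (1 : ℝ) ≤ (ℓ : ℝ) + 2 - x := by linarith [hx'.2, ℓ.cast_nonneg (α := ℝ)]
    exact ⟨one_div_nonneg.2 (by linarith), (div_le_one (by linarith)).2 this⟩
  have hint : Integrable f μLS := hf.integrable_of_measure_compl_eq_zero isCompact_Icc
    (measure_mono_null (Set.compl_subset_compl.2 Set.Ioc_subset_Icc_self) hconc)
  have hsim := eq_sum_smul_map_of_self_similar hpos hsum hmono h0 h1 hself hconc hμLS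
  have hs := hasSum_integral_measure (hsim ▸ hint)
  rw [← hsim] at hs
  have hterm : ∀ ℓ : ℕ,
      ∫ x, f x ∂(ENNReal.ofReal (q (ℓ + 2)) • μLS.map fun x => 1 / ((ℓ : ℝ) + 2 - x)) =
        (q (ℓ + 2) : ℂ) * ∫ x, f (1 / ((ℓ : ℝ) + 2 - x)) ∂μLS := fun ℓ => by
    rw [integral_smul_measure, ENNReal.toReal_ofReal (hpos _ (by omega)),
      integral_map (by fun_prop)
        (hf.integrable_of_measure_compl_eq_zero isCompact_Icc (hsupp ℓ)).aestronglyMeasurable,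
      Complex.real_smul]
  simp only [hterm] at hs
  exact ⟨hs.summable.norm, hs.tsum_eq.symm⟩
end

section
/- Fix a real number κ ∈ (0,1), and let μ : [0,1] → ℝ be a continuous nondecreasing function with μ(0)=0, μ(1)=1 and μ(1/(ℓ−x)) = (1−κ)κ^{ℓ−2}·μ(x) + κ^{ℓ−1} for all integers ℓ ≥ 2 and x ∈ [0,1]; let λ_μ be its Lebesgue–Stieltjes measure. Define G(z) = ∫_{[0,1]} x/(1−xz) dλ_μ(x) for z ∈ ℂ ∖ [1,∞). Then for every z ∈ ℂ with z ∉ [0,∞) one has G(z+1) − κ·G(z) = (1−κ)/(1−z)² · G(1/(1−z)) + (1−κ)/(1−z). -/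
open MeasureTheory

/-- Left of `1/2` the branches of index `ℓ ≥ 3` combine to a single scaling relation. -/
lemma apply_eq_mul_apply_div_one_sub {κ : ℝ} {μ : ℝ → ℝ}
    (hself : ∀ ℓ : ℕ, 2 ≤ ℓ → ∀ x ∈ Set.Icc (0 : ℝ) 1,
      μ (1 / ((ℓ : ℝ) - x)) = (1 - κ) * κ ^ (ℓ - 2) * μ x + κ ^ (ℓ - 1))
    {t : ℝ} (ht0 : 0 < t) (ht : t < 1 / 2) : μ t = κ * μ (t / (1 - t)) := by
  have hinv : 2 < 1 / t := by
    rw [lt_div_iff₀ ht0]; linarith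
  have hceil : 2 < ⌈1 / t⌉₊ := Nat.lt_ceil.2 (by exact_mod_cast hinv)
  obtain ⟨k, hk⟩ : ∃ k, ⌈1 / t⌉₊ = k + 3 := ⟨⌈1 / t⌉₊ - 3, by omega⟩
  have hle := Nat.le_ceil (1 / t)
  have hlt := Nat.ceil_lt_add_one (a := 1 / t) (by positivity)
  rw [hk] at hle hlt
  push_cast at hle hlt
  have hx : (k : ℝ) + 3 - 1 / t ∈ Set.Icc (0 : ℝ) 1 := ⟨by linarith, by linarith⟩
  have e₁ := hself (k + 3) (by omega) _ hx
  have e₂ := hself (k + 2) (by omega) _ hx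
  have h₁ : 1 / (((k + 3 : ℕ) : ℝ) - ((k : ℝ) + 3 - 1 / t)) = t := by
    push_cast
    rw [sub_sub_cancel, one_div_one_div]
  have h₂ : 1 / (((k + 2 : ℕ) : ℝ) - ((k : ℝ) + 3 - 1 / t)) = t / (1 - t) := by
    have h : ((k + 2 : ℕ) : ℝ) - ((k : ℝ) + 3 - 1 / t) = (1 - t) / t := by
      push_cast
      field_simp
      ring
    rw [h, one_div_div]
  rw [h₁] at e₁
  rw [h₂] at e₂
  rw [e₁, e₂, show k + 3 - 2 = k + 1 by omega, show k + 3 - 1 = k + 2 by omega,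
    show k + 2 - 2 = k by omega, show k + 2 - 1 = k + 1 by omega]
  ring

/-- The Lebesgue–Stieltjes measure is stationary for the two-map system
`x ↦ 1 / (2 - x)`, `x ↦ x / (1 + x)` with weights `1 - κ` and `κ`. -/
lemma eq_smul_map_add_smul_map {κ : ℝ} (hκ : κ ∈ Set.Ioo (0 : ℝ) 1) {μ : ℝ → ℝ}
    (hmono : MonotoneOn μ (Set.Icc 0 1)) (h0 : μ 0 = 0) (h1 : μ 1 = 1)
    (hself : ∀ ℓ : ℕ, 2 ≤ ℓ → ∀ x ∈ Set.Icc (0 : ℝ) 1,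
      μ (1 / ((ℓ : ℝ) - x)) = (1 - κ) * κ ^ (ℓ - 2) * μ x + κ ^ (ℓ - 1))
    {ν : Measure ℝ} [IsFiniteMeasure ν] (hae : ∀ᵐ x ∂ν, x ∈ Set.Ioc (0 : ℝ) 1)
    (hν : ∀ t ∈ Set.Icc (0 : ℝ) 1, ν (Set.Iic t) = ENNReal.ofReal (μ t)) :
    ν = ENNReal.ofReal (1 - κ) • ν.map (fun x => 1 / (2 - x)) +
      ENNReal.ofReal κ • ν.map (fun x => x / (1 + x)) := by
  have hS : Measurable fun x : ℝ => 1 / (2 - x) := by fun_prop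
  have hT : Measurable fun x : ℝ => x / (1 + x) := by fun_prop
  obtain ⟨hκ0, hκ1⟩ := hκ
  have hκ' : 0 ≤ 1 - κ := by linarith
  have hnonneg : ∀ t ∈ Set.Icc (0 : ℝ) 1, 0 ≤ μ t := fun t ht =>
    h0 ▸ hmono (by simp) ht ht.1
  have hempty : ∀ p : ℝ → Prop, (∀ x ∈ Set.Ioc (0 : ℝ) 1, ¬ p x) → ν {x | p x} = 0 := by
    intro p hp
    rw [measure_eq_zero_iff_ae_notMem]
    filter_upwards [hae] with x hx using hp x hx
  have hcongr : ∀ (p : ℝ → Prop) (s : ℝ), s ∈ Set.Icc (0 : ℝ) 1 →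
      (∀ x ∈ Set.Ioc (0 : ℝ) 1, p x ↔ x ≤ s) → ν {x | p x} = ENNReal.ofReal (μ s) := by
    intro p s hs hp
    rw [← hν s hs]
    apply measure_congr
    filter_upwards [hae] with x hx
    exact propext (hp x hx)
  refine Measure.ext_of_Iic _ _ fun t => ?_
  rw [Measure.add_apply, Measure.smul_apply, Measure.smul_apply,
    Measure.map_apply hS measurableSet_Iic, Measure.map_apply hT measurableSet_Iic]
  change ν {x | x ≤ t} = ENNReal.ofReal (1 - κ) * ν {x | 1 / (2 - x) ≤ t} +
    ENNReal.ofReal κ * ν {x | x / (1 + x) ≤ t}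
  rcases le_or_gt t 0 with ht0 | ht0
  · rw [hempty _ fun x hx h => by linarith [hx.1], hempty _ fun x hx h => ?_,
      hempty _ fun x hx h => ?_]
    · simp
    · have : 0 < x / (1 + x) := div_pos hx.1 (by linarith [hx.1])
      linarith
    · have : 0 < 1 / (2 - x) := one_div_pos.2 (by linarith [hx.2])
      linarith
  rcases lt_or_ge t (1 / 2) with ht | ht
  · have hmem : t / (1 - t) ∈ Set.Icc (0 : ℝ) 1 :=
      ⟨div_nonneg ht0.le (by linarith), (div_le_one (by linarith)).2 (by linarith)⟩
    rw [hcongr _ t ⟨ht0.le, by linarith⟩ fun x _ => Iff.rfl, hempty _ fun x hx h => ?_,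
      hcongr _ (t / (1 - t)) hmem fun x hx => ?_,
      apply_eq_mul_apply_div_one_sub hself ht0 ht, ENNReal.ofReal_mul hκ0.le, mul_zero, zero_add]
    · rw [div_le_iff₀ (by linarith [hx.1]), le_div_iff₀ (by linarith)]
      constructor <;> intro h <;> linarith
    · rw [div_le_iff₀ (by linarith [hx.2])] at h
      nlinarith [hx.1]
  have hTall : ν {x | x / (1 + x) ≤ t} = 1 := by
    rw [hcongr _ 1 (by simp) fun x hx => ?_, h1, ENNReal.ofReal_one]
    refine ⟨fun _ => hx.2, fun _ => ?_⟩
    rw [div_le_iff₀ (by linarith [hx.1])]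
    nlinarith [hx.1, hx.2]
  rw [hTall]
  rcases le_or_gt t 1 with ht1 | ht1
  · have hmem : 2 - 1 / t ∈ Set.Icc (0 : ℝ) 1 := by
      constructor
      · rw [sub_nonneg, div_le_iff₀ ht0]; linarith
      · have : 1 ≤ 1 / t := by rw [le_div_iff₀ ht0]; linarith
        linarith
    have hval := hself 2 le_rfl _ hmem
    norm_num at hval
    rw [hcongr _ t ⟨ht0.le, ht1⟩ fun x _ => Iff.rfl, hcongr _ (2 - 1 / t) hmem fun x hx => ?_,
      ← ENNReal.ofReal_mul hκ', mul_one,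
      ← ENNReal.ofReal_add (mul_nonneg hκ' (hnonneg _ hmem)) hκ0.le, one_div, hval]
    rw [one_div_le (by linarith [hx.2]) ht0]
    constructor <;> intro h <;> linarith
  · rw [hcongr _ 1 (by simp) fun x hx => ⟨fun _ => hx.2, fun _ => by linarith [hx.2]⟩,
      hcongr _ 1 (by simp) fun x hx => ⟨fun _ => hx.2, fun _ => ?_⟩, h1, ENNReal.ofReal_one,
      mul_one, mul_one, ← ENNReal.ofReal_add hκ' hκ0.le]
    · simp
    · rw [div_le_iff₀ (by linarith [hx.2])]
      nlinarith [hx.2]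

lemma one_sub_ofReal_mul_ne_zero {w : ℂ} (hw : w ∉ Complex.ofReal '' Set.Ici (1 : ℝ)) {x : ℝ}
    (hx : x ∈ Set.Icc (0 : ℝ) 1) : 1 - (x : ℂ) * w ≠ 0 := by
  intro h
  have hx0 : x ≠ 0 := by
    rintro rfl
    simp at h
  refine hw ⟨x⁻¹, (one_le_inv₀ (lt_of_le_of_ne hx.1 hx0.symm)).2 hx.2, ?_⟩
  rw [Complex.ofReal_inv]
  exact (eq_inv_of_mul_eq_one_right (sub_eq_zero.1 h).symm).symm

lemma integrable_stieltjes_kernel {ν : Measure ℝ} [IsFiniteMeasure ν]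
    (hae : ∀ᵐ x ∂ν, x ∈ Set.Ioc (0 : ℝ) 1) {w : ℂ}
    (hw : w ∉ Complex.ofReal '' Set.Ici (1 : ℝ)) :
    Integrable (fun x : ℝ => (x : ℂ) / (1 - x * w)) ν := by
  have hc : ContinuousOn (fun x : ℝ => (x : ℂ) / (1 - x * w)) (Set.Icc 0 1) :=
    ContinuousOn.div (by fun_prop) (by fun_prop) fun x hx => one_sub_ofReal_mul_ne_zero hw hx
  have hi : IntegrableOn (fun x : ℝ => (x : ℂ) / (1 - x * w)) (Set.Icc 0 1) ν :=
    hc.integrableOn_compact isCompact_Icc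
  rwa [IntegrableOn, Measure.restrict_eq_self_of_ae_mem
    (hae.mono fun x hx => Set.Ioc_subset_Icc_self hx)] at hi

/-- for `κ ∈ (0,1)` and the `κ`-question-mark function `μ`
(with `q_ℓ = (1−κ)κ^{ℓ−2}`), the Stieltjes transform
`G(z) = ∫ x/(1−xz) dλ_μ(x)` satisfies the three-term functional equation
`G(z+1) − κG(z) = (1−κ)/(1−z)² · G(1/(1−z)) + (1−κ)/(1−z)` for `z ∉ [0,∞)`. -/
theorem stieltjes_transform_three_term_equation (κ : ℝ) (hκ : κ ∈ Set.Ioo (0 : ℝ) 1)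
    (μ : ℝ → ℝ) (hcont : ContinuousOn μ (Set.Icc 0 1))
    (hmono : MonotoneOn μ (Set.Icc 0 1)) (h0 : μ 0 = 0) (h1 : μ 1 = 1)
    (hself : ∀ ℓ : ℕ, 2 ≤ ℓ → ∀ x ∈ Set.Icc (0 : ℝ) 1,
      μ (1 / ((ℓ : ℝ) - x)) = (1 - κ) * κ ^ (ℓ - 2) * μ x + κ ^ (ℓ - 1))
    (μLS : Measure ℝ) [IsFiniteMeasure μLS]
    (hconc : μLS (Set.Ioc (0 : ℝ) 1)ᶜ = 0)
    (hμLS : ∀ a ∈ Set.Icc (0 : ℝ) 1, ∀ b ∈ Set.Icc (0 : ℝ) 1, a ≤ b →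
      μLS (Set.Ioc a b) = ENNReal.ofReal (μ b - μ a))
    (G : ℂ → ℂ)
    (hG : ∀ z : ℂ, z ∉ Complex.ofReal '' Set.Ici (1 : ℝ) →
      G z = ∫ x, (x : ℂ) / (1 - x * z) ∂μLS) :
    ∀ z : ℂ, z ∉ Complex.ofReal '' Set.Ici (0 : ℝ) →
      G (z + 1) - κ * G z =
        (1 - κ) / (1 - z) ^ 2 * G (1 / (1 - z)) + (1 - κ) / (1 - z) := by
  intro z hz
  have hz1 : z + 1 ∉ Complex.ofReal '' Set.Ici (1 : ℝ) := by
    rintro ⟨r, hr, h⟩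
    refine hz ⟨r - 1, sub_nonneg.2 (Set.mem_Ici.1 hr), ?_⟩
    push_cast
    linear_combination h
  have hz0 : z ∉ Complex.ofReal '' Set.Ici (1 : ℝ) := fun h =>
    hz (Set.image_mono (Set.Ici_subset_Ici.2 zero_le_one) h)
  have hzsub : ∀ x ∈ Set.Icc (0 : ℝ) 1, 1 - z - (x : ℂ) ≠ 0 := by
    intro x hx h
    refine hz ⟨1 - x, sub_nonneg.2 hx.2, ?_⟩
    push_cast
    linear_combination h
  have hne : 1 - z ≠ 0 := by simpa using hzsub 0 (by simp)
  have hzw : 1 / (1 - z) ∉ Complex.ofReal '' Set.Ici (1 : ℝ) := by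
    rintro ⟨r, hr, h⟩
    have hr1 : (1 : ℝ) ≤ r := hr
    refine hzsub r⁻¹ ⟨by positivity, inv_le_one_of_one_le₀ hr1⟩ ?_
    push_cast
    rw [h]
    simp
  have hae : ∀ᵐ x ∂μLS, x ∈ Set.Ioc (0 : ℝ) 1 := hconc
  have hIic : ∀ t ∈ Set.Icc (0 : ℝ) 1, μLS (Set.Iic t) = ENNReal.ofReal (μ t) := by
    intro t ht
    rw [← sub_zero (μ t), ← h0, ← hμLS 0 (by simp) t ht ht.1]
    apply measure_congr
    filter_upwards [hae] with x hx
    exact propext ⟨fun h => ⟨hx.1, h⟩, fun h => h.2⟩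
  have huniv : μLS.real Set.univ = 1 := by
    have : μLS Set.univ = μLS (Set.Ioc 0 1) := by
      apply measure_congr
      filter_upwards [hae] with x hx
      exact propext ⟨fun _ => hx, fun _ => trivial⟩
    rw [measureReal_def, this, hμLS 0 (by simp) 1 (by simp) zero_le_one, h0, h1]
    simp
  have hdec := eq_smul_map_add_smul_map hκ hmono h0 h1 hself hae hIic
  have hmeas : Measurable fun x : ℝ => (x : ℂ) / (1 - x * (z + 1)) := by fun_prop
  have hint := integrable_stieltjes_kernel hae hz1
  have key : ∫ x, (x : ℂ) / (1 - x * (z + 1)) ∂μLS =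
      (1 - κ) * ∫ x : ℝ, 1 / (1 - z - (x : ℂ)) ∂μLS +
        κ * ∫ x, (x : ℂ) / (1 - x * z) ∂μLS := by
    rw [hdec, integrable_add_measure] at hint
    conv_lhs => rw [hdec]
    rw [integral_add_measure hint.1 hint.2, integral_smul_measure, integral_smul_measure,
      integral_map (by fun_prop) hmeas.aestronglyMeasurable,
      integral_map (by fun_prop) hmeas.aestronglyMeasurable,
      ENNReal.toReal_ofReal (sub_nonneg.2 hκ.2.le), ENNReal.toReal_ofReal hκ.1.le,
      Complex.real_smul, Complex.real_smul]
    push_cast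
    congr 2
    · refine integral_congr_ae ?_
      filter_upwards [hae] with x hx
      have h₁ := hzsub x ⟨hx.1.le, hx.2⟩
      have h₂ : (2 : ℂ) - x ≠ 0 := by
        have : (2 : ℝ) - x ≠ 0 := by linarith [hx.2]
        exact_mod_cast this
      have h₃ : 1 - 1 / ((2 : ℂ) - x) * (z + 1) = (1 - z - x) / (2 - x) := by
        field_simp
        ring
      rw [h₃]
      field_simp
    · refine integral_congr_ae ?_
      filter_upwards [hae] with x hx
      have h₁ := one_sub_ofReal_mul_ne_zero hz0 ⟨hx.1.le, hx.2⟩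
      have h₂ : (1 : ℂ) + x ≠ 0 := by
        have : (1 : ℝ) + x ≠ 0 := by linarith [hx.1]
        exact_mod_cast this
      have h₃ : 1 - (x : ℂ) / (1 + x) * (z + 1) = (1 - x * z) / (1 + x) := by
        field_simp
        ring
      rw [h₃, div_div_div_cancel_right₀ h₂]
  have hlast : ∫ x : ℝ, 1 / (1 - z - (x : ℂ)) ∂μLS =
      1 / (1 - z) + 1 / (1 - z) ^ 2 * ∫ x, (x : ℂ) / (1 - x * (1 / (1 - z))) ∂μLS := by
    have hsplit := integral_add (integrable_const (1 / (1 - z)))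
      ((integrable_stieltjes_kernel hae hzw).const_mul (1 / (1 - z) ^ 2))
    rw [integral_const, huniv, one_smul, integral_const_mul] at hsplit
    rw [← hsplit]
    refine integral_congr_ae ?_
    filter_upwards [hae] with x hx
    have h₁ := hzsub x ⟨hx.1.le, hx.2⟩
    have h₃ : 1 - (x : ℂ) * (1 / (1 - z)) = (1 - z - x) / (1 - z) := by
      field_simp
    rw [h₃]
    field_simp
    ring
  rw [hG _ hz1, hG _ hz0, hG _ hzw, key, hlast]
  ring
end

section
/- Let k be an even positive integer and let A, B : ℍ → ℂ be functions on the upper half-plane such that for every κ ∈ ℂ and every z ∈ ℍ, A(z) + κ·B(z) = κ·[A(z−1) + κ·B(z−1)] + (1−κ)·(1−z)^{−k}·[A(z/(1−z)) + κ·B(z/(1−z))]. Then for all z ∈ ℍ: (i) A(z) = (z+1)^{−k}·A(z/(z+1)); (ii) A(z+1) + B(z+1) = A(z) + B(z); and (iii) B(z) = z^{−k}·B(−(z+1)/z). -/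
/-- if `A(z) + κB(z)` satisfies the three-term functional
equation for every `κ ∈ ℂ`, then `A = A|R`, `A + B = (A+B)|T` and
`B = B|SUS` (weight-`k` slash actions written out explicitly). -/
theorem height_one_coordinate_relations (k : ℤ) (hk : Even k) (hk0 : 0 < k)
    (A B : ℂ → ℂ)
    (hfe : ∀ κ : ℂ, ∀ z : ℂ, 0 < z.im →
      A z + κ * B z =
        κ * (A (z - 1) + κ * B (z - 1)) +
        (1 - κ) * (1 - z) ^ (-k) * (A (z / (1 - z)) + κ * B (z / (1 - z)))) :
    ∀ z : ℂ, 0 < z.im →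
      A z = (z + 1) ^ (-k) * A (z / (z + 1)) ∧
      A (z + 1) + B (z + 1) = A z + B z ∧
      B z = z ^ (-k) * B (-(z + 1) / z) := by
  intro z hz
  have hz0 : z ≠ 0 := by rintro rfl; simp at hz
  have hz1 : z + 1 ≠ 0 := by
    intro h
    have := congrArg Complex.im h
    simp at this
    exact hz.ne' this
  refine ⟨?_, ?_, ?_⟩
  · have him : 0 < (z / (z + 1)).im := by
      have h : z / (z + 1) = 1 - (z + 1)⁻¹ := by field_simp; ring
      have hn : 0 < Complex.normSq (z + 1) := Complex.normSq_pos.mpr hz1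
      rw [h, Complex.sub_im, Complex.inv_im]
      simp only [Complex.add_im, Complex.one_im, add_zero, zero_sub, neg_div, neg_neg]
      positivity
    have h := hfe 0 _ him
    have h1 : 1 - z / (z + 1) = (z + 1)⁻¹ := by field_simp; ring
    have h2 : z / (z + 1) / (z + 1)⁻¹ = z := by field_simp
    rw [h1, h2] at h
    simp only [zero_mul, add_zero, zero_add, sub_zero, one_mul, inv_zpow', neg_neg] at h
    rw [h, ← mul_assoc, ← zpow_add₀ hz1]
    simp
  · simpa using hfe 1 (z + 1) (by simpa using hz)
  · have him : 0 < (z + 1).im := by simpa using hz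
    have h0 := hfe 0 _ him
    have h1 := hfe 1 _ him
    have h2 := hfe (-1) _ him
    have hs : 1 - (z + 1) = -z := by ring
    have hd : (z + 1) / -z = -(z + 1) / z := by rw [div_neg, neg_div]
    rw [hs, hd, hk.neg.neg_zpow, add_sub_cancel_right] at h0 h1 h2
    linear_combination (h0 - (h1 + h2) / 2)
end

section
/- Let k be an even positive integer and A : ℍ → ℂ a function on the upper half-plane. Write (A|γ)(z) = (cz+d)^{−k} A((az+b)/(cz+d)) for γ = (a b; c d) ∈ SL₂(ℤ), and set S = (0 1; −1 0), U = (0 1; −1 1). If A + A|S = A|(SUS) + A|(SU) identically on ℍ, then also A + A|U + A|U² = A|(SUS) + A|(SUSU) + A|(SUSU²) identically on ℍ. -/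
/-- for even `k`, the identity `A|(I−SUS)(I+S) = 0` implies
`A|(I−SUS)(I+U+U²) = 0`, written out via the explicit weight-`k` slash
actions of the matrices involved. -/
theorem slash_identity_consequence (k : ℤ) (hk : Even k) (hk0 : 0 < k)
    (A : ℂ → ℂ)
    (h : ∀ z : ℂ, 0 < z.im →
      A z + z ^ (-k) * A (-1 / z) =
        z ^ (-k) * A (-(z + 1) / z) + A (z - 1)) :
    ∀ z : ℂ, 0 < z.im →
      A z + (1 - z) ^ (-k) * A (1 / (1 - z)) + z ^ (-k) * A (1 - 1 / z) =
        z ^ (-k) * A (-(z + 1) / z) + A (z - 2) +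
          (1 - z) ^ (-k) * A ((2 * z - 1) / (1 - z)) := by
  intro z hz
  have hz0 : z ≠ 0 := by
    rintro rfl
    simp at hz
  have hz1 : 1 - z ≠ 0 := by
    intro h0
    rw [← sub_eq_zero.mp h0] at hz
    simp at hz
  have hu : 0 < (1 / (1 - z)).im := by
    rw [one_div, Complex.inv_im]
    exact div_pos (by simpa using hz) (Complex.normSq_pos.mpr hz1)
  have hv : 0 < (1 - 1 / z).im := by
    rw [one_div, Complex.sub_im, Complex.inv_im, Complex.one_im, zero_sub, neg_div, neg_neg]
    exact div_pos hz (Complex.normSq_pos.mpr hz0)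
  have hv_eq : 1 - 1 / z = -((1 - z) / z) := by
    field_simp
    ring
  have e₁ : -1 / (1 / (1 - z)) = z - 1 := by
    field_simp
    ring
  have e₂ : -(1 / (1 - z) + 1) / (1 / (1 - z)) = z - 2 := by
    field_simp
    ring
  have e₃ : 1 / (1 - z) - 1 = z / (1 - z) := by
    field_simp
    ring
  have e₄ : -1 / (1 - 1 / z) = z / (1 - z) := by
    rw [hv_eq]
    field_simp
  have e₅ : -(1 - 1 / z + 1) / (1 - 1 / z) = (2 * z - 1) / (1 - z) := by
    rw [hv_eq]
    field_simp
    ring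
  have e₆ : 1 - 1 / z - 1 = -1 / z := by ring
  have hU := h _ hu
  have hU' := h _ hv
  rw [e₁, e₂, e₃] at hU
  rw [e₄, e₅, e₆] at hU'
  have p₁ : (1 - z) ^ (-k) * (1 / (1 - z)) ^ (-k) = 1 := by
    rw [← mul_zpow, mul_one_div_cancel hz1, one_zpow]
  have p₂ : z ^ (-k) * (1 - 1 / z) ^ (-k) = (1 - z) ^ (-k) := by
    rw [hv_eq, hk.neg.neg_zpow, ← mul_zpow, mul_div_cancel₀ _ hz0]
  linear_combination h z hz + (1 - z) ^ (-k) * hU + z ^ (-k) * hU' -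
    (A (z - 1) - A (z - 2)) * p₁ - (A (z / (1 - z)) - A ((2 * z - 1) / (1 - z))) * p₂
end

section
/- Let k be an even positive integer and C : ℍ → ℂ a function on the upper half-plane satisfying C(z+1) = C(z) for all z ∈ ℍ, and C(z) + z^{−k}·C(−1/z) = (z+1)^{−k}·C(−1/(z+1)) + (z−1)^{−k}·C(−1/(z−1)) for all z ∈ ℍ. Then for all z ∈ ℍ: 2·C(z) = z^{−k}·C(−1/z) + (z+3)^{−k}·C(−1/(z+3)), and 3·C(z) = z^{−k}·C(−1/z) + (z+2)^{−k}·C(−1/(z+2)) + (z+4)^{−k}·C(−1/(z+4)). -/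
/-- a 1-periodic `C` on ℍ satisfying
`C(z) + z^{−k}C(−1/z) = (z+1)^{−k}C(−1/(z+1)) + (z−1)^{−k}C(−1/(z−1))`
also satisfies the two averaged identities of Proposition 4. -/
theorem periodic_three_term_implies_averaged (k : ℤ) (hk : Even k) (hk0 : 0 < k)
    (C : ℂ → ℂ)
    (hper : ∀ z : ℂ, 0 < z.im → C (z + 1) = C z)
    (h : ∀ z : ℂ, 0 < z.im →
      C z + z ^ (-k) * C (-1 / z) =
        (z + 1) ^ (-k) * C (-1 / (z + 1)) + (z - 1) ^ (-k) * C (-1 / (z - 1))) :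
    ∀ z : ℂ, 0 < z.im →
      (2 * C z = z ^ (-k) * C (-1 / z) + (z + 3) ^ (-k) * C (-1 / (z + 3))) ∧
      (3 * C z = z ^ (-k) * C (-1 / z) + (z + 2) ^ (-k) * C (-1 / (z + 2)) +
        (z + 4) ^ (-k) * C (-1 / (z + 4))) := by
  intro z hz
  have him : ∀ n : ℕ, 0 < (z + n).im := fun n => by simpa using hz
  have hC : ∀ n : ℕ, C (z + n) = C z := by
    intro n
    induction n with
    | zero => simp
    | succ n ih => rw [Nat.cast_succ, ← add_assoc, hper _ (him n), ih]
  have three_term : ∀ n : ℕ,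
      C z + (z + (n + 1)) ^ (-k) * C (-1 / (z + (n + 1))) =
        (z + (n + 2)) ^ (-k) * C (-1 / (z + (n + 2))) +
          (z + n) ^ (-k) * C (-1 / (z + n)) := by
    intro n
    have key := h (z + (n + 1 : ℕ)) (him (n + 1))
    rw [hC, Nat.cast_succ, show z + ((n : ℂ) + 1) + 1 = z + (n + 2) by ring,
      show z + ((n : ℂ) + 1) - 1 = z + n by ring] at key
    exact key
  have h₀ := three_term 0
  have h₁ := three_term 1
  have h₂ := three_term 2
  norm_num only [Nat.cast_zero, Nat.cast_one, Nat.cast_ofNat, zero_add, add_zero] at h₀ h₁ h₂ ⊢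
  exact ⟨by linear_combination h₀ + h₁, by linear_combination h₀ + h₁ + h₂⟩
end

section
/- Let k be an even positive integer and C : ℍ → ℂ a function on the upper half-plane satisfying C(z+1) = C(z) for all z ∈ ℍ, together with the two identities 2·C(z) = z^{−k}·C(−1/z) + (z+3)^{−k}·C(−1/(z+3)) and 3·C(z) = z^{−k}·C(−1/z) + (z+2)^{−k}·C(−1/(z+2)) + (z+4)^{−k}·C(−1/(z+4)) for all z ∈ ℍ. Then C also satisfies C(z) + z^{−k}·C(−1/z) = (z+1)^{−k}·C(−1/(z+1)) + (z−1)^{−k}·C(−1/(z−1)) for all z ∈ ℍ. -/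
/-- conversely, the two averaged identities for a 1-periodic `C`
imply the original identity
`C(z) + z^{−k}C(−1/z) = (z+1)^{−k}C(−1/(z+1)) + (z−1)^{−k}C(−1/(z−1))`. -/
theorem averaged_implies_periodic_three_term (k : ℤ) (hk : Even k) (hk0 : 0 < k)
    (C : ℂ → ℂ)
    (hper : ∀ z : ℂ, 0 < z.im → C (z + 1) = C z)
    (h2 : ∀ z : ℂ, 0 < z.im →
      2 * C z = z ^ (-k) * C (-1 / z) + (z + 3) ^ (-k) * C (-1 / (z + 3)))
    (h3 : ∀ z : ℂ, 0 < z.im →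
      3 * C z = z ^ (-k) * C (-1 / z) + (z + 2) ^ (-k) * C (-1 / (z + 2)) +
        (z + 4) ^ (-k) * C (-1 / (z + 4))) :
    ∀ z : ℂ, 0 < z.im →
      C z + z ^ (-k) * C (-1 / z) =
        (z + 1) ^ (-k) * C (-1 / (z + 1)) + (z - 1) ^ (-k) * C (-1 / (z - 1)) := by
  intro z hz
  have hz' : 0 < (z - 1).im := by simpa using hz
  have hC := hper (z - 1) hz'
  have h3z := h3 (z - 1) hz'
  rw [show z - 1 + 1 = z by ring] at hC
  rw [show z - 1 + 2 = z + 1 by ring, show z - 1 + 4 = z + 3 by ring] at h3z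
  linear_combination h3z - h2 z hz + 3 * hC
end

section
/- Let k be an even positive integer and C : ℍ → ℂ a function on the upper half-plane satisfying C(z+1) = C(z) for all z ∈ ℍ, together with 2·C(z) = z^{−k}·C(−1/z) + (z+3)^{−k}·C(−1/(z+3)) and 3·C(z) = z^{−k}·C(−1/z) + (z+2)^{−k}·C(−1/(z+2)) + (z+4)^{−k}·C(−1/(z+4)) for all z ∈ ℍ. Then C(z) = (1−6z)^{−k}·C(z/(1−6z)) for all z ∈ ℍ. -/
/-- the two averaged identities for a 1-periodic `C` imply the
invariance `C(z) = (1−6z)^{−k} C(z/(1−6z))` under a generator of `Γ₁(6)`. -/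
theorem averaged_implies_gamma1_six_invariance (k : ℤ) (hk : Even k) (hk0 : 0 < k)
    (C : ℂ → ℂ)
    (hper : ∀ z : ℂ, 0 < z.im → C (z + 1) = C z)
    (h2 : ∀ z : ℂ, 0 < z.im →
      2 * C z = z ^ (-k) * C (-1 / z) + (z + 3) ^ (-k) * C (-1 / (z + 3)))
    (h3 : ∀ z : ℂ, 0 < z.im →
      3 * C z = z ^ (-k) * C (-1 / z) + (z + 2) ^ (-k) * C (-1 / (z + 2)) +
        (z + 4) ^ (-k) * C (-1 / (z + 4))) :
    ∀ z : ℂ, 0 < z.im →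
      C z = (1 - 6 * z) ^ (-k) * C (z / (1 - 6 * z)) := by
  intro z hz
  have hz0 : z ≠ 0 := by rintro rfl; simp at hz
  have hd : 1 - 6 * z ≠ 0 := by
    intro h
    have := congrArg Complex.im h
    simp at this
    exact hz.ne' this
  have key : ∀ w : ℂ, 0 < w.im →
      w ^ (-k) * C (-1 / w) = (w + 6) ^ (-k) * C (-1 / (w + 6)) := by
    intro w hw
    have hper3 : C (w + 3) = C w := by
      have e : w + 3 = w + 1 + 1 + 1 := by ring
      rw [e, hper _ (by simpa using hw), hper _ (by simpa using hw), hper _ hw]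
    have h := h2 w hw
    have h' := h2 (w + 3) (by simpa using hw)
    rw [hper3, show w + 3 + 3 = w + 6 by ring] at h'
    linear_combination h' - h
  have hw : 0 < (-1 / z).im := by
    rw [neg_div, one_div, Complex.neg_im, Complex.inv_im, neg_div, neg_neg]
    exact div_pos hz (Complex.normSq_pos.mpr hz0)
  have h := key (-1 / z) hw
  have e₁ : -1 / z + 6 = -((1 - 6 * z) / z) := by field_simp; ring
  have e₂ : -1 / -((1 - 6 * z) / z) = z / (1 - 6 * z) := by field_simp
  have e₃ : -1 / (-1 / z) = z := by field_simp
  rw [e₁, e₂, e₃, neg_div, hk.neg.neg_zpow, hk.neg.neg_zpow, div_zpow, div_zpow, one_zpow,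
    div_mul_eq_mul_div, div_mul_eq_mul_div, one_mul,
    div_left_inj' (zpow_ne_zero _ hz0)] at h
  exact h
end

section
/- For each κ ∈ (0,1) let μ_κ : [0,1] → ℝ be a continuous nondecreasing function with μ_κ(0) = 0, μ_κ(1) = 1 and μ_κ(1/(ℓ−x)) = (1−κ)·κ^{ℓ−2}·μ_κ(x) + κ^{ℓ−1} for all integers ℓ ≥ 2 and x ∈ [0,1]. Then for every fixed x ∈ [0,1), μ_κ(x) → 0 as κ → 0⁺, and for every fixed x ∈ (0,1], μ_κ(x) → 1 as κ → 1⁻. In particular, μ_κ converges pointwise on [0,1] as κ → 0⁺ to the function equal to 0 on [0,1) and 1 at x = 1, and as κ → 1⁻ to the function equal to 0 at x = 0 and 1 on (0,1]. -/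
/-- The branch `x ↦ 1 / (2 - x)` maps `n / (n + 1)` to `(n + 1) / (n + 2)`, so iterating its
functional equation from `0` determines the values at these points. -/
theorem eq_one_sub_pow_of_branch_two {f : ℝ → ℝ} {κ : ℝ} (h0 : f 0 = 0)
    (hf : ∀ x ∈ Set.Icc (0 : ℝ) 1, f (1 / (2 - x)) = (1 - κ) * f x + κ) (n : ℕ) :
    f (1 - 1 / ((n : ℝ) + 1)) = 1 - (1 - κ) ^ n := by
  induction n with
  | zero => simp [h0]
  | succ n ih =>
    have hn : (0 : ℝ) < (n : ℝ) + 1 := by positivity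
    have hle : 1 / ((n : ℝ) + 1) ≤ 1 := by
      rw [div_le_one hn]; linarith [n.cast_nonneg (α := ℝ)]
    have hpos : 0 < 1 / ((n : ℝ) + 1) := by positivity
    have key := hf (1 - 1 / ((n : ℝ) + 1)) ⟨by linarith, by linarith⟩
    have harg : 1 / (2 - (1 - 1 / ((n : ℝ) + 1))) = 1 - 1 / (((n + 1 : ℕ) : ℝ) + 1) := by
      have h2 : 2 - (1 - 1 / ((n : ℝ) + 1)) = ((n : ℝ) + 2) / ((n : ℝ) + 1) := by
        field_simp; ring
      rw [h2]
      push_cast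
      field_simp
      ring
    rw [harg, ih] at key
    rw [key]
    ring

/-- pointwise limits of the `κ`-question-mark functions `μ_κ`
as `κ → 0⁺` and `κ → 1⁻`. -/
theorem q_question_mark_pointwise_limits (μ : ℝ → ℝ → ℝ)
    (hcont : ∀ κ ∈ Set.Ioo (0 : ℝ) 1, ContinuousOn (μ κ) (Set.Icc 0 1))
    (hmono : ∀ κ ∈ Set.Ioo (0 : ℝ) 1, MonotoneOn (μ κ) (Set.Icc 0 1))
    (h0 : ∀ κ ∈ Set.Ioo (0 : ℝ) 1, μ κ 0 = 0)
    (h1 : ∀ κ ∈ Set.Ioo (0 : ℝ) 1, μ κ 1 = 1)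
    (hself : ∀ κ ∈ Set.Ioo (0 : ℝ) 1, ∀ ℓ : ℕ, 2 ≤ ℓ → ∀ x ∈ Set.Icc (0 : ℝ) 1,
      μ κ (1 / ((ℓ : ℝ) - x)) = (1 - κ) * κ ^ (ℓ - 2) * μ κ x + κ ^ (ℓ - 1)) :
    (∀ x ∈ Set.Ico (0 : ℝ) 1,
      Filter.Tendsto (fun κ => μ κ x) (nhdsWithin 0 (Set.Ioo 0 1)) (nhds 0)) ∧
    (∀ x ∈ Set.Ioc (0 : ℝ) 1,
      Filter.Tendsto (fun κ => μ κ x) (nhdsWithin 1 (Set.Ioo 0 1)) (nhds 1)) := by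
  refine ⟨fun x hx => ?_, fun x hx => ?_⟩
  · obtain ⟨n, hn⟩ := exists_nat_one_div_lt (sub_pos.2 hx.2)
    have hpos : 0 < 1 / ((n : ℝ) + 1) := by positivity
    have hlim : Filter.Tendsto (fun κ : ℝ => 1 - (1 - κ) ^ n)
        (nhdsWithin 0 (Set.Ioo 0 1)) (nhds 0) := by
      have hc : Continuous fun κ : ℝ => 1 - (1 - κ) ^ n := by fun_prop
      simpa using (hc.tendsto 0).mono_left nhdsWithin_le_nhds
    refine tendsto_of_tendsto_of_tendsto_of_le_of_le' tendsto_const_nhds hlim ?_ ?_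
    · filter_upwards [self_mem_nhdsWithin] with κ hκ
      rw [← h0 κ hκ]
      exact hmono κ hκ ⟨le_rfl, zero_le_one⟩ ⟨hx.1, hx.2.le⟩ hx.1
    · filter_upwards [self_mem_nhdsWithin] with κ hκ
      rw [← eq_one_sub_pow_of_branch_two (h0 κ hκ)
        (fun y hy => by simpa using hself κ hκ 2 le_rfl y hy) n]
      exact hmono κ hκ ⟨hx.1, hx.2.le⟩ ⟨by linarith [hx.1], by linarith⟩ (by linarith)
  · obtain ⟨n, hn⟩ := exists_nat_one_div_lt hx.1
    have hle : 1 / ((n + 2 : ℕ) : ℝ) ≤ x := by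
      refine le_trans ?_ hn.le
      push_cast
      gcongr
      norm_num
    have hlim : Filter.Tendsto (fun κ : ℝ => κ ^ (n + 1))
        (nhdsWithin 1 (Set.Ioo 0 1)) (nhds 1) := by
      simpa using ((continuous_pow (M := ℝ) (n + 1)).tendsto 1).mono_left nhdsWithin_le_nhds
    refine tendsto_of_tendsto_of_tendsto_of_le_of_le' hlim tendsto_const_nhds ?_ ?_
    · filter_upwards [self_mem_nhdsWithin] with κ hκ
      have key := hself κ hκ (n + 2) (by omega) 0 ⟨le_rfl, zero_le_one⟩
      rw [h0 κ hκ, sub_zero, mul_zero, zero_add, show n + 2 - 1 = n + 1 by omega] at key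
      rw [← key]
      exact hmono κ hκ ⟨by positivity, hle.trans hx.2⟩ ⟨hx.1.le, hx.2⟩ hle
    · filter_upwards [self_mem_nhdsWithin] with κ hκ
      rw [← h1 κ hκ]
      exact hmono κ hκ ⟨hx.1.le, hx.2⟩ ⟨zero_le_one, le_rfl⟩ hx.2
end
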